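/- arXiv:math/0211200 — 12 statements merged into one kernel-verified Lean document; each statement's English description precedes it below -/
import Mathlib

section
/- If W is a Sturmian word and n is a positive integer, then the n-dimensional Lebesgue measure of the convex hull of the n+1 points of F_n(W) in ℝ^n equals 1/n!. -/
/-- The set of factors of length `n` of a binary word `W : ℕ → ℕ`
(with values in `{0,1}`), regarded as a set of vectors in `ℝ^n`. -/
def factorSet (W : ℕ → ℕ) (n : ℕ) : Set (Fin n → ℝ) :=
  {v | ∃ i : ℕ, ∀ j : Fin n, v j = (W (i + (j : ℕ)) : ℝ)}

section

open MeasureTheory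
open scoped Pointwise

/-- The corner simplex of side `r` in `ℝ^n`: nonnegative coordinates with sum at most `r`. -/
def solidSimplex (n : ℕ) (r : ℝ) : Set (Fin n → ℝ) :=
  {x | (∀ i, 0 ≤ x i) ∧ ∑ i, x i ≤ r}

theorem isClosed_solidSimplex (n : ℕ) (r : ℝ) : IsClosed (solidSimplex n r) := by
  have : solidSimplex n r = (⋂ i, {x | 0 ≤ x i}) ∩ {x | ∑ i, x i ≤ r} := by
    ext x; simp [solidSimplex]
  rw [this]
  exact (isClosed_iInter fun i => isClosed_le (by fun_prop) (by fun_prop)).inter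
    (isClosed_le (by fun_prop) (by fun_prop))

theorem volume_solidSimplex (n : ℕ) {r : ℝ} (hr : 0 ≤ r) :
    volume (solidSimplex n r) = ENNReal.ofReal (r ^ n / n.factorial) := by
  induction n generalizing r with
  | zero =>
    have : solidSimplex 0 r = Set.univ := by ext x; simp [solidSimplex, hr]
    simp [this, volume_pi]
  | succ n ih =>
    have hmp := (volume_preserving_piFinSuccAbove (fun _ : Fin (n + 1) => ℝ) 0).symm
    have hmeas := (isClosed_solidSimplex (n + 1) r).measurableSet
    rw [← hmp.measure_preimage hmeas.nullMeasurableSet, Measure.volume_eq_prod,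
      Measure.prod_apply (hmp.measurable hmeas)]
    have hslice : ∀ t : ℝ, volume (Prod.mk t ⁻¹'
        ((MeasurableEquiv.piFinSuccAbove (fun _ : Fin (n + 1) => ℝ) 0).symm ⁻¹'
          solidSimplex (n + 1) r)) =
        (Set.Icc 0 r).indicator (fun t => ENNReal.ofReal ((r - t) ^ n / n.factorial)) t := by
      intro t
      by_cases ht : t ∈ Set.Icc 0 r
      · rw [Set.indicator_of_mem ht, ← ih (sub_nonneg.2 ht.2)]
        congr 1
        ext x
        simp [solidSimplex, MeasurableEquiv.piFinSuccAbove, Fin.forall_fin_succ, Fin.sum_univ_succ,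
          Fin.insertNthEquiv, ht.1, le_sub_iff_add_le']
      · rw [Set.indicator_of_notMem ht]
        convert measure_empty (μ := (volume : Measure (Fin n → ℝ)))
        rw [Set.eq_empty_iff_forall_notMem]
        intro x hx
        simp only [solidSimplex, MeasurableEquiv.piFinSuccAbove, Fin.forall_fin_succ,
          Fin.sum_univ_succ, Fin.insertNthEquiv, Set.mem_preimage, Set.mem_ofPred_eq] at hx
        simp at hx
        exact ht ⟨hx.1.1, by linarith [Finset.sum_nonneg fun i (_ : i ∈ Finset.univ) => hx.1.2 i]⟩
    simp_rw [hslice]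
    rw [lintegral_indicator measurableSet_Icc, ← ofReal_integral_eq_lintegral_ofReal]
    · rw [integral_Icc_eq_integral_Ioc, ← intervalIntegral.integral_of_le hr,
        intervalIntegral.integral_div,
        intervalIntegral.integral_comp_sub_left (fun x => x ^ n) r]
      simp [Nat.factorial_succ, div_div]
    · exact (by fun_prop : Continuous fun t : ℝ => (r - t) ^ n / n.factorial).integrableOn_Icc
    · filter_upwards [ae_restrict_mem measurableSet_Icc] with t ht
      have := sub_nonneg.2 ht.2
      positivity

theorem convexHull_insert_zero_range_single (n : ℕ) :
    convexHull ℝ (insert 0 (Set.range fun i : Fin n => Pi.single i (1 : ℝ))) =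
      solidSimplex n 1 := by
  apply Set.Subset.antisymm
  · refine convexHull_min ?_ ?_
    · rintro _ (rfl | ⟨i, rfl⟩)
      · simp [solidSimplex]
      · refine ⟨fun j => ?_, by simp⟩
        simp only [Pi.single_apply]; split_ifs <;> norm_num
    · rintro x ⟨hx, hx'⟩ y ⟨hy, hy'⟩ a b ha hb hab
      refine ⟨fun i => ?_, ?_⟩
      · have := hx i
        have := hy i
        simp only [Pi.add_apply, Pi.smul_apply, smul_eq_mul]
        positivity
      · simp only [Pi.add_apply, Pi.smul_apply, smul_eq_mul, Finset.sum_add_distrib,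
          ← Finset.mul_sum]
        nlinarith
  · rintro x ⟨hx, hx'⟩
    have := (convex_convexHull ℝ
      (insert 0 (Set.range fun i : Fin n => Pi.single i (1 : ℝ)))).sum_mem
      (t := Finset.univ) (w := Fin.cons (1 - ∑ i, x i) x)
      (z := Fin.cons 0 fun i : Fin n => Pi.single i (1 : ℝ)) ?_ ?_ ?_
    · convert this
      ext j
      simp [Fin.sum_univ_succ, Finset.sum_apply, Pi.single_apply]
    · intro i _
      refine Fin.cases ?_ (fun j => ?_) i
      · simpa using hx'
      · simpa using hx j
    · simp [Fin.sum_univ_succ]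
    · intro i _
      apply subset_convexHull
      refine Fin.cases ?_ (fun j => ?_) i <;> simp

/-- The volume of the simplex with vertices `v i` as a determinant. -/
theorem volume_convexHull_range_eq {n : ℕ} (v : Fin (n + 1) → Fin n → ℝ) :
    volume (convexHull ℝ (Set.range v)) =
      ENNReal.ofReal (|(Matrix.of fun i => (Fin.cons 1 (v i) : Fin (n + 1) → ℝ)).det| /
        n.factorial) := by
  set A : Matrix (Fin n) (Fin n) ℝ := Matrix.of fun i j => v i.succ j - v 0 j with hA
  have hdet : (Matrix.of fun i => (Fin.cons 1 (v i) : Fin (n + 1) → ℝ)).det = A.det := by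
    rw [Matrix.det_eq_of_forall_row_eq_smul_add_const
      (B := Matrix.of (Fin.cons (Fin.cons 1 (v 0)) fun i => Fin.cons 0 (A i)))
      (Fin.cons 0 fun _ => 1) 0 rfl, Matrix.det_succ_column_zero, Fin.sum_univ_succ]
    · simp [Matrix.submatrix]
      rfl
    · intro i j
      refine Fin.cases ?_ (fun i => ?_) i <;> refine Fin.cases ?_ (fun j => ?_) j <;> simp [hA]
  have hrange : Set.range v = v 0 +ᵥ
      Matrix.toLin' A.transpose '' insert 0 (Set.range fun i : Fin n => Pi.single i (1 : ℝ)) := by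
    rw [Set.image_insert_eq, map_zero, ← Set.range_comp, ← Set.image_vadd, Set.image_insert_eq,
      ← Set.range_comp, ← Set.singleton_union, Fin.range_fin_succ, Set.singleton_union]
    congr 1
    · simp
    · congr 1
      ext i j
      simp [hA, Fin.tail]
  rw [hrange, convexHull_vadd, measure_vadd, ← LinearMap.image_convexHull,
    convexHull_insert_zero_range_single, Measure.addHaar_image_linearMap,
    volume_solidSimplex n zero_le_one, LinearMap.det_toLin', Matrix.det_transpose, hdet,
    ← ENNReal.ofReal_mul (abs_nonneg _)]
  simp [div_eq_mul_inv]

/-- Adding a coordinate to the rows of a square matrix and then repeating one row with another last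
entry multiplies the determinant, up to sign, by the difference of the two last entries. -/
theorem abs_det_snoc_rows {n : ℕ} (u : Fin (n + 1) → Fin (n + 1) → ℝ) (a : Fin (n + 1) → ℝ)
    (k : Fin (n + 1)) (b : ℝ) :
    |(Matrix.of (Fin.snoc (fun i => Fin.snoc (u i) (a i)) (Fin.snoc (u k) b) :
      Fin (n + 2) → Fin (n + 2) → ℝ)).det| = |b - a k| * |(Matrix.of u).det| := by
  set M : Matrix (Fin (n + 2)) (Fin (n + 2)) ℝ :=
    Matrix.of (Fin.snoc (fun i => Fin.snoc (u i) (a i)) (Fin.snoc (u k) b)) with hM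
  rw [← Matrix.det_updateRow_add_smul_self M (i := Fin.last _) (j := k.castSucc)
    (Fin.castSucc_lt_last k).ne' (-1), Matrix.det_succ_row _ (Fin.last _), Fin.sum_univ_castSucc]
  have hsub : ∀ x : Fin (n + 2) → ℝ, (M.updateRow (Fin.last _) x).submatrix
      (Fin.last _).succAbove (Fin.last _).succAbove = Matrix.of u := by
    intro x
    ext i j
    simp [hM]
  rw [hsub]
  simp [hM, abs_mul, ← sub_eq_add_neg]

/-- The factors of length `n` of a Sturmian word are the vertices of a unimodular simplex. -/
theorem exists_enumeration_factorSet (W : ℕ → ℕ) (hW : ∀ i, W i = 0 ∨ W i = 1)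
    (hSturmian : ∀ m : ℕ, 0 < m → (factorSet W m).ncard = m + 1) (n : ℕ) :
    ∃ v : Fin (n + 1) → Fin n → ℝ, Function.Injective v ∧ Set.range v = factorSet W n ∧
      |(Matrix.of fun i => (Fin.cons 1 (v i) : Fin (n + 1) → ℝ)).det| = 1 := by
  induction n with
  | zero =>
    refine ⟨fun _ => Fin.elim0, fun i j _ => Subsingleton.elim (α := Fin 1) i j, ?_, by simp⟩
    ext x
    simp [factorSet, Subsingleton.elim x Fin.elim0]
  | succ n ih =>
    obtain ⟨v, hv, hrange, hdet⟩ := ih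
    have hmem : ∀ i, ∃ p : ℕ, ∀ j : Fin n, v i j = W (p + j) := fun i =>
      (hrange ▸ Set.mem_range_self i : v i ∈ factorSet W n)
    choose p hp using hmem
    set e : Fin (n + 1) → Fin (n + 1) → ℝ := fun i => Fin.snoc (v i) (W (p i + n) : ℝ) with he
    have he_inj : Function.Injective e := fun i j hij => hv (Fin.snoc_inj.1 hij).1
    have hcard := hSturmian (n + 1) n.succ_pos
    obtain ⟨w, ⟨q, hq⟩, hwe⟩ : ∃ w ∈ factorSet W (n + 1), w ∉ Set.range e := by
      refine Set.exists_mem_notMem_of_ncard_lt_ncard ?_ (Set.finite_range e)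
      rw [Set.ncard_range_of_injective he_inj, hcard]
      simp
    obtain ⟨k, hk⟩ : Fin.init w ∈ Set.range v := by
      rw [hrange]
      exact ⟨q, fun j => hq j.castSucc⟩
    have hw : w = Fin.snoc (v k) (W (q + n) : ℝ) := by
      have hlast : (W (q + n) : ℝ) = w (Fin.last n) := (hq (Fin.last n)).symm
      rw [hk, hlast, Fin.snoc_init_self]
    have hne : W (q + n) ≠ W (p k + n) := fun h => hwe ⟨k, by rw [hw, h]⟩
    have hinj : Function.Injective (Fin.snoc e w : Fin (n + 2) → Fin (n + 1) → ℝ) :=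
      Fin.snoc_injective_iff.2 ⟨he_inj, hwe⟩
    refine ⟨Fin.snoc e w, hinj, ?_, ?_⟩
    · apply Set.eq_of_subset_of_ncard_le
      · rintro _ ⟨i, rfl⟩
        refine Fin.lastCases ?_ (fun i => ?_) i
        · rw [Fin.snoc_last]
          exact ⟨q, hq⟩
        · rw [Fin.snoc_castSucc]
          refine ⟨p i, fun j => ?_⟩
          refine Fin.lastCases ?_ (fun j => ?_) j
          · simp [he]
          · simp [he, hp]
      · rw [Set.ncard_range_of_injective hinj, hcard]
        simp
      · exact Set.finite_of_ncard_pos (by omega)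
    · have hrows : (fun i => (Fin.cons 1 ((Fin.snoc e w : Fin (n + 2) → Fin (n + 1) → ℝ) i) :
          Fin (n + 2) → ℝ)) =
          Fin.snoc (fun i => Fin.snoc (Fin.cons 1 (v i) : Fin (n + 1) → ℝ) (W (p i + n) : ℝ))
            (Fin.snoc (Fin.cons 1 (v k) : Fin (n + 1) → ℝ) (W (q + n) : ℝ)) := by
        funext i
        refine Fin.lastCases ?_ (fun i => ?_) i
        · simp only [Fin.snoc_last]
          rw [hw, Fin.cons_snoc_eq_snoc_cons]
        · simp only [Fin.snoc_castSucc, he]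
          rw [Fin.cons_snoc_eq_snoc_cons]
      rw [hrows, abs_det_snoc_rows (fun i => Fin.cons 1 (v i)) (fun i => (W (p i + n) : ℝ)), hdet]
      rcases hW (q + n) with h | h <;> rcases hW (p k + n) with h' | h' <;>
        rw [h, h'] at hne ⊢ <;> simp at hne ⊢

end

/-- If `W` is a Sturmian word and `n` is a positive integer, then the `n`-dimensional
Lebesgue measure of the convex hull of the `n+1` points of `F_n(W)` in `ℝ^n`
equals `1/n!`. -/
theorem sturmian_simplex_volume (W : ℕ → ℕ) (hW : ∀ i, W i = 0 ∨ W i = 1)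
    (hSturmian : ∀ m : ℕ, 0 < m → (factorSet W m).ncard = m + 1)
    (n : ℕ) (hn : 0 < n) :
    MeasureTheory.volume (convexHull ℝ (factorSet W n)) =
      ENNReal.ofReal (1 / (n.factorial : ℝ)) := by
  obtain ⟨v, -, hrange, hdet⟩ := exists_enumeration_factorSet W hW hSturmian n
  rw [← hrange, volume_convexHull_range_eq, hdet]
end

section
/- For every irrational α ∈ (0,1) and every positive integer n, the determinant of the matrix M_n(α) equals 1 or −1. -/
/-- The characteristic word of slope `α`: `c_α(i) = ⌊(i+2)α⌋ − ⌊(i+1)α⌋`. -/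
noncomputable def charWord (α : ℝ) (i : ℕ) : ℤ := ⌊((i : ℝ) + 2) * α⌋ - ⌊((i : ℝ) + 1) * α⌋

/-- `F_n(α)`: the set of factors of length `n` of the characteristic word `c_α`,
regarded as a set of vectors in `ℤ^n`. -/
def charFactors (α : ℝ) (n : ℕ) : Set (Fin n → ℤ) :=
  {v | ∃ i : ℕ, ∀ j : Fin n, v j = charWord α (i + (j : ℕ))}

/-- Lexicographic order (most significant coordinate first) on `ℤ^n`. -/
def lexLt {n : ℕ} (x y : Fin n → ℤ) : Prop :=
  ∃ m : Fin n, (∀ l : Fin n, l < m → x l = y l) ∧ x m < y m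

/-- An antitone family of `n + 1` vectors with two consecutive values in each coordinate, whose
members are pairwise distinct, has a difference matrix of determinant `±1`. -/
theorem det_sub_last_of_antitone {n : ℕ} (s : Fin (n + 1) → Fin n → ℤ) (b : Fin n → ℤ)
    (hlow : ∀ j k, b k ≤ s j k) (hupp : ∀ j k, s j k ≤ b k + 1) (hs : Antitone s)
    (hlt : ∀ i j, i < j → ∃ k, s j k < s i k) :
    Matrix.det (Matrix.of fun k j : Fin n => s j.castSucc k - s (Fin.last n) k) = 1 ∨
      Matrix.det (Matrix.of fun k j : Fin n => s j.castSucc k - s (Fin.last n) k) = -1 := by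
  choose σ hσ using fun i : Fin n => hlt i.castSucc i.succ i.castSucc_lt_succ
  have hone : ∀ i : Fin n, ∀ j : Fin (n + 1), j ≤ i.castSucc → s j (σ i) = b (σ i) + 1 := by
    intro i j hij
    have h₁ : s i.castSucc (σ i) ≤ s j (σ i) := hs hij (σ i)
    have h₂ := hσ i
    have h₃ := hlow i.succ (σ i)
    have h₄ := hupp j (σ i)
    omega
  have hzero : ∀ i : Fin n, ∀ j : Fin (n + 1), i.succ ≤ j → s j (σ i) = b (σ i) := by
    intro i j hij
    have h₁ : s j (σ i) ≤ s i.succ (σ i) := hs hij (σ i)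
    have h₂ := hσ i
    have h₃ := hlow j (σ i)
    have h₄ := hupp i.castSucc (σ i)
    omega
  have hne : ∀ i j : Fin n, i < j → σ i ≠ σ j := by
    intro i j hij h
    have h₁ := hone j j.castSucc le_rfl
    have h₂ := hzero i j.castSucc (Fin.succ_le_castSucc_iff.2 hij)
    rw [h] at h₂
    omega
  have hinj : Function.Injective σ := by
    intro i j h
    by_contra hij
    rcases lt_or_gt_of_ne hij with h' | h'
    · exact hne i j h' h
    · exact hne j i h' h.symm
  let e : Equiv.Perm (Fin n) := Equiv.ofBijective σ (Finite.injective_iff_bijective.1 hinj)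
  set N : Matrix (Fin n) (Fin n) ℤ :=
    Matrix.of fun k j : Fin n => s j.castSucc k - s (Fin.last n) k with hN
  have hentry : ∀ i j, N.submatrix e id i j = s j.castSucc (σ i) - b (σ i) := by
    intro i j
    rw [← hzero i (Fin.last n) (Fin.le_last _)]
    rfl
  have htri : (N.submatrix e id).BlockTriangular OrderDual.toDual := by
    intro i j hij
    have hij' : i < j := hij
    rw [hentry, hzero i j.castSucc (Fin.succ_le_castSucc_iff.2 hij'), sub_self]
  have hdet : (N.submatrix e id).det = 1 := by
    rw [Matrix.det_of_isLowerTriangular _ htri]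
    refine Finset.prod_eq_one fun i _ => ?_
    rw [hentry, hone i i.castSucc le_rfl]
    ring
  rw [Matrix.det_permute] at hdet
  exact Int.isUnit_iff.1 (IsUnit.of_mul_eq_one_right _ hdet)

theorem sum_ite_le_sub {n : ℕ} (g : ℕ → ℤ) (k : Fin n) :
    ∑ l : Fin n, (if l ≤ k then g (l + 1) - g l else 0) = g (k + 1) - g 0 := by
  rw [← Finset.sum_range_sub g (k + 1)]
  have h := Fin.sum_univ_eq_sum_range
    (fun l : ℕ => if l ≤ (k : ℕ) then g (l + 1) - g l else 0) n
  simp only [Fin.le_def]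
  rw [h, ← Finset.sum_filter]
  refine Finset.sum_congr ?_ fun _ _ => rfl
  ext l
  have := k.isLt
  simp only [Finset.mem_filter, Finset.mem_range]
  omega

/-- Prefix sums of a factor of the characteristic word are values of `⌊x + (k + 1)α⌋`. -/
theorem sum_ite_le_charWord {n : ℕ} (α : ℝ) (i : ℕ) (k : Fin n) :
    ∑ l : Fin n, (if l ≤ k then charWord α (i + l) else 0) =
      ⌊Int.fract (((i : ℝ) + 1) * α) + ((k : ℕ) + 1) * α⌋ := by
  have h := sum_ite_le_sub (fun m => ⌊((i : ℝ) + m + 1) * α⌋) k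
  have hw : ∀ l : ℕ, charWord α (i + l) =
      ⌊((i : ℝ) + (l + 1 : ℕ) + 1) * α⌋ - ⌊((i : ℝ) + l + 1) * α⌋ := by
    intro l
    rw [charWord]
    push_cast
    ring_nf
  simp only [hw]
  rw [h, Int.fract, sub_add_eq_add_sub, Int.floor_sub_intCast]
  push_cast
  ring_nf

/-- For irrational `α ∈ (0,1)` and `n ≥ 1`, listing `F_n(α)` in anti-lexicographic
(i.e. lexicographically decreasing) order as `v_1, …, v_{n+1}`, the matrix `M_n(α)`
whose `j`-th column is `v_j − v_{n+1}` has determinant `1` or `−1`. -/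
theorem det_charFactors_matrix (α : ℝ) (hα : Irrational α) (h0 : 0 < α) (h1 : α < 1)
    (n : ℕ) (hn : 0 < n) (v : Fin (n + 1) → (Fin n → ℤ))
    (hrange : Set.range v = charFactors α n)
    (hanti : ∀ i j : Fin (n + 1), i < j → lexLt (v j) (v i)) :
    Matrix.det (Matrix.of fun i j : Fin n => v (Fin.castSucc j) i - v (Fin.last n) i) = 1 ∨
      Matrix.det (Matrix.of fun i j : Fin n => v (Fin.castSucc j) i - v (Fin.last n) i) = -1 := by
  have hmem : ∀ j, v j ∈ charFactors α n := fun j => hrange ▸ Set.mem_range_self j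
  choose p hp using hmem
  let x : Fin (n + 1) → ℝ := fun j => Int.fract (((p j : ℝ) + 1) * α)
  let s : Fin (n + 1) → Fin n → ℤ := fun j k => ∑ l : Fin n, if l ≤ k then v j l else 0
  have hs : ∀ j k, s j k = ⌊x j + ((k : ℕ) + 1) * α⌋ := by
    intro j k
    simp only [s, hp]
    exact sum_ite_le_charWord α (p j) k
  have hmono : ∀ i j, x i ≤ x j → ∀ k, s i k ≤ s j k := by
    intro i j hij k
    rw [hs, hs]
    gcongr
  have hlt : ∀ i j, i < j → ∃ k, s j k < s i k := by
    intro i j hij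
    obtain ⟨m, heq, hm⟩ := hanti i j hij
    refine ⟨m, Finset.sum_lt_sum (fun l _ => ?_) ⟨m, Finset.mem_univ m, by simpa using hm⟩⟩
    split_ifs with hl
    · rcases hl.lt_or_eq with h | rfl
      · exact (heq l h).le
      · exact hm.le
    · exact le_rfl
  have hantitone : Antitone s := by
    intro i j hij
    rcases hij.lt_or_eq with h | rfl
    · refine hmono j i (le_of_not_ge fun hx => ?_)
      obtain ⟨k, hk⟩ := hlt i j h
      exact (hmono i j hx k).not_gt hk
    · exact le_rfl
  have key := det_sub_last_of_antitone s (fun k => ⌊((k : ℕ) + 1) * α⌋)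
    (fun j k => by
      rw [hs]
      exact Int.floor_mono (le_add_of_nonneg_left (Int.fract_nonneg _)))
    (fun j k => by
      rw [hs, ← Int.floor_add_one]
      refine Int.floor_mono ?_
      have : x j < 1 := Int.fract_lt_one _
      linarith)
    hantitone hlt
  let L : Matrix (Fin n) (Fin n) ℤ := Matrix.of fun k l => if l ≤ k then 1 else 0
  have hL : L.det = 1 := by
    have htri : L.BlockTriangular OrderDual.toDual := by
      intro k l hkl
      have hkl' : k < l := hkl
      simp [L, hkl'.not_ge]
    rw [Matrix.det_of_isLowerTriangular _ htri]
    simp [L]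
  have hmul : (Matrix.of fun k j : Fin n => s j.castSucc k - s (Fin.last n) k) =
      L * Matrix.of fun i j : Fin n => v (Fin.castSucc j) i - v (Fin.last n) i := by
    ext k j
    simp only [s, L, Matrix.mul_apply, Matrix.of_apply, ite_mul, one_mul, zero_mul]
    rw [← Finset.sum_sub_distrib]
    refine Finset.sum_congr rfl fun l _ => ?_
    split_ifs <;> simp
  rwa [hmul, Matrix.det_mul, hL, one_mul] at key
end

section
/- For every irrational real number α, there are infinitely many positive integers n such that ord(π_{α,n}) < n. -/
/-- `a / b < α < c / d` are neighbouring fractions with positive denominators. -/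
structure IsFareyInterval (α : ℝ) (a b c d : ℤ) : Prop where
  left_pos : 0 < b
  right_pos : 0 < d
  det : b * c - a * d = 1
  left_lt : (a : ℝ) < b * α
  lt_right : d * α < (c : ℝ)

namespace IsFareyInterval

variable {α : ℝ} {a b c d : ℤ}

theorem neg (h : IsFareyInterval α a b c d) : IsFareyInterval (-α) (-c) d (-a) b where
  left_pos := h.right_pos
  right_pos := h.left_pos
  det := by linarith [h.det]
  left_lt := by push_cast; linarith [h.lt_right]
  lt_right := by push_cast; linarith [h.left_lt]

/-- One of the two halves cut out by the mediant is again a Farey interval around `α`. -/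
theorem mediant (h : IsFareyInterval α a b c d) (hα : Irrational α) :
    IsFareyInterval α (a + c) (b + d) c d ∨ IsFareyInterval α a b (a + c) (b + d) := by
  have hb := h.left_pos
  have hd := h.right_pos
  have hdet := h.det
  have hne : ((a + c : ℤ) : ℝ) ≠ (b + d : ℤ) * α := fun e =>
    (hα.intCast_mul (show b + d ≠ 0 by lia)).ne_int (a + c) e.symm
  rcases lt_or_gt_of_ne hne with hlt | hlt
  · exact .inl ⟨by lia, hd, by linarith, hlt, h.lt_right⟩
  · exact .inr ⟨hb, by lia, by linarith, h.left_lt, hlt⟩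

theorem exists_odd_odd_of_odd_even (hα : Irrational α) (h : IsFareyInterval α a b c d)
    (hb : Odd b) (hd : Even d) :
    ∃ a' b' c' d', IsFareyInterval α a' b' c' d' ∧ Odd b' ∧ Odd d' ∧ b + d < b' + d' := by
  obtain ⟨N, hN⟩ := exists_nat_gt ((b * α - a) / (c - d * α))
  rw [div_lt_iff₀ (by linarith [h.lt_right])] at hN
  induction N generalizing a b with
  | zero => norm_num at hN; linarith [h.left_lt]
  | succ N ih =>
    have hb0 := h.left_pos
    have hd0 := h.right_pos
    rcases h.mediant hα with h' | h'
    · obtain ⟨a', b', c', d', h₁, h₂, h₃, h₄⟩ :=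
        ih h' (hb.add_even hd) (by push_cast at hN ⊢; linarith)
      exact ⟨a', b', c', d', h₁, h₂, h₃, by lia⟩
    · exact ⟨_, _, _, _, h', hb, hb.add_even hd, by lia⟩

theorem exists_odd_odd_of_even_odd (hα : Irrational α) (h : IsFareyInterval α a b c d)
    (hb : Even b) (hd : Odd d) :
    ∃ a' b' c' d', IsFareyInterval α a' b' c' d' ∧ Odd b' ∧ Odd d' ∧ b + d < b' + d' := by
  obtain ⟨a', b', c', d', h₁, h₂, h₃, h₄⟩ := h.neg.exists_odd_odd_of_odd_even hα.neg hd hb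
  exact ⟨_, _, _, _, by simpa using h₁.neg, h₃, h₂, by lia⟩

theorem exists_odd_odd_lt (hα : Irrational α) (h : IsFareyInterval α a b c d)
    (hb : Odd b) (hd : Odd d) :
    ∃ a' b' c' d', IsFareyInterval α a' b' c' d' ∧ Odd b' ∧ Odd d' ∧ b + d < b' + d' := by
  have hb0 := h.left_pos
  have hd0 := h.right_pos
  rcases h.mediant hα with h' | h'
  · obtain ⟨a', b', c', d', h₁, h₂, h₃, h₄⟩ :=
      h'.exists_odd_odd_of_even_odd hα (hb.add_odd hd) hd
    exact ⟨a', b', c', d', h₁, h₂, h₃, by lia⟩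
  · obtain ⟨a', b', c', d', h₁, h₂, h₃, h₄⟩ :=
      h'.exists_odd_odd_of_odd_even hα hb (hb.add_odd hd)
    exact ⟨a', b', c', d', h₁, h₂, h₃, by lia⟩

theorem exists_odd_odd_gt (hα : Irrational α) (N : ℕ) :
    ∃ a b c d, IsFareyInterval α a b c d ∧ Odd b ∧ Odd d ∧ (N : ℤ) < b + d := by
  induction N with
  | zero =>
    refine ⟨⌊α⌋, 1, ⌊α⌋ + 1, 1, ⟨one_pos, one_pos, by ring, ?_, ?_⟩, odd_one, odd_one, by simp⟩
    · simpa using lt_of_le_of_ne (Int.floor_le α) (hα.ne_int _).symm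
    · simp
  | succ N ih =>
    obtain ⟨a, b, c, d, h, hb, hd, hN⟩ := ih
    obtain ⟨a', b', c', d', h₁, h₂, h₃, h₄⟩ := h.exists_odd_odd_lt hα hb hd
    exact ⟨a', b', c', d', h₁, h₂, h₃, by push_cast; lia⟩

/-- For `|m| < b + d`, the sign of `m * α - t` is that of `m * p / q - t`, where `p / q` is the
mediant. -/
theorem lt_mul_of_mediant (h : IsFareyInterval α a b c d) {m t : ℤ} (hm : |m| < b + d)
    (hj : 0 < m * (a + c) - (b + d) * t) : (t : ℝ) < m * α := by
  obtain ⟨hb, hd, hdet, hl, hr⟩ := h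
  obtain ⟨hm₁, hm₂⟩ := abs_lt.1 hm
  obtain ⟨x, hx⟩ : ∃ x, x = m * c - t * d := ⟨_, rfl⟩
  obtain ⟨y, hy⟩ : ∃ y, y = t * b - m * a := ⟨_, rfl⟩
  have hmxy : m = x * b + y * d := by
    rw [hx, hy]; linear_combination (-m) * hdet
  have htxy : t = x * a + y * c := by
    rw [hx, hy]; linear_combination (-t) * hdet
  have hxy : y < x := by rw [hx, hy]; linarith
  have hx0 : 0 ≤ x := by
    by_contra! hneg
    nlinarith [mul_nonneg (show 0 ≤ -1 - x by lia) hb.le,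
      mul_nonneg (show 0 ≤ -1 - y by lia) hd.le]
  have hy0 : y ≤ 0 := by
    by_contra! hpos
    nlinarith [mul_nonneg (show 0 ≤ x - 1 by lia) hb.le,
      mul_nonneg (show 0 ≤ y - 1 by lia) hd.le]
  have key : (m : ℝ) * α - t = x * (b * α - a) + (-y) * (c - d * α) := by
    rw [hmxy, htxy]; push_cast; ring
  have hx0' : (0 : ℝ) ≤ x := by exact_mod_cast hx0
  have hy0' : (0 : ℝ) ≤ -y := by exact_mod_cast neg_nonneg.2 hy0
  rw [← sub_pos, key]
  rcases hx0.lt_or_eq with hpos | hzero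
  · have : (0 : ℝ) < x := by exact_mod_cast hpos
    have := mul_pos this (sub_pos.2 hl)
    have := mul_nonneg hy0' (sub_pos.2 hr).le
    linarith
  · have : (0 : ℝ) < -y := by exact_mod_cast (show 0 < -y by lia)
    have := mul_pos this (sub_pos.2 hr)
    have := mul_nonneg hx0' (sub_pos.2 hl).le
    linarith

theorem exists_mul_mediant_eq (h : IsFareyInterval α a b c d) (j : ℤ) :
    ∃ t, (b * j % (b + d)) * (a + c) = (b + d) * t + j := by
  have hdvd : b + d ∣ (b * j % (b + d)) * (a + c) - j := by
    refine ⟨a * j - (b * j / (b + d)) * (a + c), ?_⟩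
    rw [Int.emod_def]
    linear_combination j * h.det
  obtain ⟨t, ht⟩ := hdvd
  exact ⟨t, by linarith⟩

theorem fract_mul_lt (h : IsFareyInterval α a b c d) {i j : ℤ} (hi : 0 < i) (hij : i < j)
    (hj : j < b + d) :
    Int.fract (((b * i % (b + d) : ℤ) : ℝ) * α) < Int.fract (((b * j % (b + d) : ℤ) : ℝ) * α) := by
  have hb := h.left_pos
  have hd := h.right_pos
  have hq : 0 < b + d := by lia
  have fract_eq : ∀ {k m t : ℤ}, 0 < k → k < b + d → 0 ≤ m → m < b + d →
      m * (a + c) = (b + d) * t + k → Int.fract ((m : ℝ) * α) = m * α - t := by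
    intro k m t hk hkq hm hmq e
    have h₁ := h.lt_mul_of_mediant (m := m) (t := t) (by rw [abs_lt]; lia) (by linarith)
    have h₂ := h.lt_mul_of_mediant (m := -m) (t := -t - 1) (by rw [abs_lt]; lia) (by linarith)
    push_cast at h₂
    rw [Int.fract_eq_iff]
    exact ⟨by linarith, by linarith, t, by ring⟩
  obtain ⟨s, hs⟩ := h.exists_mul_mediant_eq i
  obtain ⟨t, ht⟩ := h.exists_mul_mediant_eq j
  have hi₀ := Int.emod_nonneg (b * i) hq.ne'
  have hi₁ := Int.emod_lt_of_pos (b * i) hq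
  have hj₀ := Int.emod_nonneg (b * j) hq.ne'
  have hj₁ := Int.emod_lt_of_pos (b * j) hq
  rw [fract_eq hi (hij.trans hj) hi₀ hi₁ hs, fract_eq (hi.trans hij) hj hj₀ hj₁ ht]
  generalize b * i % (b + d) = m at *
  generalize b * j % (b + d) = m' at *
  have := h.lt_mul_of_mediant (m := m' - m) (t := t - s) (by rw [abs_lt]; lia) (by linarith)
  push_cast at this
  linarith

end IsFareyInterval

/-- Multiplication by a unit modulo `n + 1`, as a permutation of `{1, …, n}`. -/
theorem exists_perm_mul_mod {b n : ℕ} (hb : b.Coprime (n + 1)) :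
    ∃ π : Equiv.Perm (Fin n), (∀ k, (π k : ℕ) + 1 = b * (k + 1) % (n + 1)) ∧
      orderOf π ≤ (n + 1).totient := by
  have hpos (k : Fin n) : 0 < b * (k + 1) % (n + 1) := by
    refine Nat.pos_of_ne_zero fun h0 => ?_
    have := Nat.le_of_dvd (by lia) (hb.symm.dvd_of_dvd_mul_left (Nat.dvd_of_mod_eq_zero h0))
    lia
  have hlt (k : Fin n) : b * (k + 1) % (n + 1) < n + 1 := Nat.mod_lt _ n.succ_pos
  let f : Fin n → Fin n := fun k =>
    ⟨b * (k + 1) % (n + 1) - 1, Nat.sub_one_lt_of_le (hpos k) (Nat.lt_succ_iff.1 (hlt k))⟩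
  have hf (k : Fin n) : (f k : ℕ) + 1 = b * (k + 1) % (n + 1) := Nat.sub_add_cancel (hpos k)
  have hinj : Function.Injective f := by
    intro k l hkl
    have hmod : b * (k + 1) ≡ b * (l + 1) [MOD n + 1] := by
      rw [Nat.ModEq, ← hf, ← hf, hkl]
    have := (Nat.ModEq.cancel_left_of_coprime hb.symm hmod).eq_of_lt_of_lt (by lia) (by lia)
    exact Fin.ext (by lia)
  let π : Equiv.Perm (Fin n) := Equiv.ofBijective f (Finite.injective_iff_bijective.1 hinj)
  refine ⟨π, hf, orderOf_le_of_pow_eq_one (Nat.totient_pos.2 n.succ_pos) ?_⟩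
  have hpow (r : ℕ) (k : Fin n) : ((π ^ r) k : ℕ) + 1 ≡ b ^ r * (k + 1) [MOD n + 1] := by
    induction r with
    | zero => simp [Nat.ModEq]
    | succ r ih =>
      have hstep : (π ((π ^ r) k) : ℕ) + 1 ≡ b * (((π ^ r) k : ℕ) + 1) [MOD n + 1] := by
        rw [show (π ((π ^ r) k) : ℕ) + 1 = _ from hf _]
        exact Nat.mod_modEq _ _
      rw [pow_succ' π, Equiv.Perm.mul_apply, pow_succ' b, mul_assoc]
      exact hstep.trans (ih.mul_left b)
  ext k
  have hone := (Nat.ModEq.pow_totient hb).mul_right ((k : ℕ) + 1)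
  have := ((hpow _ k).trans hone).eq_of_lt_of_lt (by lia) (by lia)
  simpa using this

theorem Nat.totient_lt_pred_of_not_prime {q : ℕ} (h1 : 1 < q) (hq : ¬ q.Prime) :
    q.totient < q - 1 := by
  have := Nat.totient_lt q h1
  have := mt (Nat.totient_eq_iff_prime (by lia)).1 hq
  lia


/-- `IsOrderingPerm α n π` says that `π` is the permutation of `{1, …, n}` (encoded
0-based as a permutation of `Fin n`) ordering the fractional parts
`{α}, {2α}, …, {nα}`:  `{π(1)α} < {π(2)α} < … < {π(n)α}`. -/
def IsOrderingPerm (α : ℝ) (n : ℕ) (π : Equiv.Perm (Fin n)) : Prop :=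
  ∀ k l : Fin n, k < l →
    Int.fract (((π k : ℕ) + 1 : ℝ) * α) < Int.fract (((π l : ℕ) + 1 : ℝ) * α)

/-- For every irrational real `α`, there are infinitely many positive integers `n`
such that `ord(π_{α,n}) < n`. -/
theorem infinitely_many_small_order (α : ℝ) (hα : Irrational α) :
    {n : ℕ | 0 < n ∧ ∃ π : Equiv.Perm (Fin n),
        IsOrderingPerm α n π ∧ orderOf π < n}.Infinite := by
  refine Set.infinite_of_not_bddAbove fun ⟨M, hM⟩ => ?_
  obtain ⟨a, b, c, d, h, hb, hd, hlt⟩ := IsFareyInterval.exists_odd_odd_gt hα (M + 2)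
  lift b to ℕ using h.left_pos.le
  lift d to ℕ using h.right_pos.le
  obtain ⟨n, hn⟩ : ∃ n, b + d = n + 1 := ⟨b + d - 1, by lia⟩
  have hnZ : (b : ℤ) + d = n + 1 := by exact_mod_cast hn
  have hcop : b.Coprime (n + 1) := by
    rw [← hn, Nat.coprime_self_add_right, ← Nat.isCoprime_iff_coprime]
    exact ⟨c, -a, by linarith [h.det]⟩
  obtain ⟨π, hπ, hord⟩ := exists_perm_mul_mod hcop
  have hprime : ¬ (n + 1).Prime := fun hp => by
    have heven : Even (b + d) := by exact_mod_cast hb.add_odd hd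
    have := hp.even_iff.1 (hn ▸ heven)
    lia
  have hφ := Nat.totient_lt_pred_of_not_prime (by lia) hprime
  have hcast (k : Fin n) :
      ((π k : ℕ) + 1 : ℝ) = (((b : ℤ) * ((k : ℕ) + 1 : ℤ) % ((b : ℤ) + d) : ℤ) : ℝ) := by
    rw [hnZ]
    exact_mod_cast hπ k
  have hmem := hM ⟨show 0 < n by lia, π, fun k l hkl => ?_, by lia⟩
  · lia
  · rw [hcast, hcast]
    exact h.fract_mul_lt (by lia) (by have := Fin.lt_def.1 hkl; lia) (by have := l.isLt; lia)
end

section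
/- For every irrational real number α and every positive integer n, sgn(π_{α,2n}) = sgn(π_{α,2n+1}) = ∏_{ℓ=1}^n (−1)^{⌊2ℓα⌋}, where sgn denotes the sign of a permutation and ⌊x⌋ the integer part of x. -/
lemma irrational_fract_ne {α : ℝ} (hα : Irrational α) {a b : ℕ} (hab : a ≠ b) :
    Int.fract (a * α) ≠ Int.fract (b * α) := by
  rw [Ne, Int.fract_eq_fract]
  rintro ⟨z, hz⟩
  refine (hα.intCast_mul (m := (a : ℤ) - b) (by omega)).ne_int z ?_
  push_cast
  linarith

/-- The indicator of an inversion between `a` and `a + d` is the defect of additivity of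
`k ↦ ⌊k * α⌋`. -/
lemma ite_fract_lt_eq_zpow {α : ℝ} (hα : Irrational α) (a d : ℕ) (hd : d ≠ 0) :
    (if Int.fract ((a : ℝ) * α) < Int.fract (((a + d : ℕ) : ℝ) * α) then (1 : ℤˣ) else -1) =
      (-1) ^ (⌊((a + d : ℕ) : ℝ) * α⌋ - ⌊(a : ℝ) * α⌋ - ⌊(d : ℝ) * α⌋) := by
  have hne := irrational_fract_ne hα (show a ≠ a + d by omega)
  have key : ((⌊((a + d : ℕ) : ℝ) * α⌋ - ⌊(a : ℝ) * α⌋ - ⌊(d : ℝ) * α⌋ : ℤ) : ℝ) =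
      Int.fract ((a : ℝ) * α) + Int.fract ((d : ℝ) * α)
        - Int.fract (((a + d : ℕ) : ℝ) * α) := by
    simp only [Int.fract]
    push_cast
    ring
  generalize ⌊((a + d : ℕ) : ℝ) * α⌋ - ⌊(a : ℝ) * α⌋ - ⌊(d : ℝ) * α⌋ = z at key ⊢
  have h1 := Int.fract_nonneg ((a : ℝ) * α)
  have h2 := Int.fract_lt_one ((a : ℝ) * α)
  have h3 := Int.fract_nonneg ((d : ℝ) * α)
  have h4 := Int.fract_lt_one ((d : ℝ) * α)
  have h5 := Int.fract_nonneg (((a + d : ℕ) : ℝ) * α)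
  have h6 := Int.fract_lt_one (((a + d : ℕ) : ℝ) * α)
  split_ifs with h
  · have hz1 : -1 < z := by exact_mod_cast (by push_cast; linarith : ((-1 : ℤ) : ℝ) < z)
    have hz2 : z < 1 := by exact_mod_cast (by push_cast; linarith : (z : ℝ) < (1 : ℤ))
    obtain rfl : z = 0 := by omega
    simp
  · have h' := lt_of_le_of_ne (not_lt.mp h) hne.symm
    have hz1 : 0 < z := by exact_mod_cast (by push_cast; linarith : ((0 : ℤ) : ℝ) < z)
    have hz2 : z < 2 := by exact_mod_cast (by push_cast; linarith : (z : ℝ) < (2 : ℤ))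
    obtain rfl : z = 1 := by omega
    simp

lemma prod_range_ite_fract_lt {α : ℝ} (hα : Irrational α) (j : ℕ) :
    ∏ i ∈ Finset.range j, (if Int.fract (((i + 1 : ℕ) : ℝ) * α) <
        Int.fract (((j + 1 : ℕ) : ℝ) * α) then (1 : ℤˣ) else -1) =
      ((-1) ^ ⌊((j + 1 : ℕ) : ℝ) * α⌋) ^ j := by
  have h : ∀ i ∈ Finset.range j, (if Int.fract (((i + 1 : ℕ) : ℝ) * α) <
        Int.fract (((j + 1 : ℕ) : ℝ) * α) then (1 : ℤˣ) else -1) =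
      (-1) ^ ⌊((j + 1 : ℕ) : ℝ) * α⌋ / (-1) ^ ⌊((i + 1 : ℕ) : ℝ) * α⌋ /
        (-1) ^ ⌊((j - 1 - i + 1 : ℕ) : ℝ) * α⌋ := by
    intro i hi
    rw [Finset.mem_range] at hi
    have h := ite_fract_lt_eq_zpow hα (i + 1) (j - 1 - i + 1) (by omega)
    rw [show i + 1 + (j - 1 - i + 1) = j + 1 by omega] at h
    rw [h, zpow_sub, zpow_sub]
    simp only [div_eq_mul_inv]
  rw [Finset.prod_congr rfl h, Finset.prod_div_distrib, Finset.prod_div_distrib,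
    Finset.prod_const, Finset.card_range,
    Finset.prod_range_reflect (fun i ↦ (-1 : ℤˣ) ^ ⌊((i + 1 : ℕ) : ℝ) * α⌋) j,
    div_div, Int.units_mul_self, div_one]

lemma IsOrderingPerm.symm_lt_symm_iff {α : ℝ} {N : ℕ} {π : Equiv.Perm (Fin N)}
    (hπ : IsOrderingPerm α N π) (i j : Fin N) :
    π.symm i < π.symm j ↔
      Int.fract (((i + 1 : ℕ) : ℝ) * α) < Int.fract (((j + 1 : ℕ) : ℝ) * α) := by
  have hmono : StrictMono fun k ↦ Int.fract (((π k : ℕ) + 1 : ℝ) * α) := fun k l ↦ hπ k l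
  simpa using (hmono.lt_iff_lt (a := π.symm i) (b := π.symm j)).symm

lemma IsOrderingPerm.sign_eq_prod_range {α : ℝ} (hα : Irrational α) {N : ℕ}
    {π : Equiv.Perm (Fin N)} (hπ : IsOrderingPerm α N π) :
    Equiv.Perm.sign π =
      ∏ j ∈ Finset.range N, ((-1 : ℤˣ) ^ ⌊((j + 1 : ℕ) : ℝ) * α⌋) ^ j := by
  rw [← Equiv.Perm.sign_symm, Equiv.Perm.sign_eq_prod_prod_Iio, ← Fin.prod_univ_eq_prod_range]
  refine Finset.prod_congr rfl fun j _ ↦ ?_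
  simp only [hπ.symm_lt_symm_iff]
  rw [← prod_range_ite_fract_lt hα, ← Nat.Iio_eq_range, ← Fin.map_valEmbedding_Iio,
    Finset.prod_map]
  rfl

lemma prod_range_two_mul_pow (u : ℕ → ℤˣ) (n : ℕ) :
    ∏ j ∈ Finset.range (2 * n), u (j + 1) ^ j = ∏ ℓ ∈ Finset.Icc 1 n, u (2 * ℓ) := by
  induction n with
  | zero => simp
  | succ n ih =>
    rw [Finset.prod_Icc_succ_top (by omega), ← ih, mul_add, mul_one, Finset.prod_range_succ,
      Finset.prod_range_succ, pow_succ (u (2 * n + 1 + 1)), pow_mul, pow_mul]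
    simp [Int.units_sq]

/-- For every irrational `α` and positive integer `n`,
`sgn(π_{α,2n}) = sgn(π_{α,2n+1}) = ∏_{ℓ=1}^n (-1)^{⌊2ℓα⌋}`. -/
theorem sign_orderingPerm (α : ℝ) (hα : Irrational α) (n : ℕ) (hn : 0 < n)
    (π₂ : Equiv.Perm (Fin (2 * n))) (hπ₂ : IsOrderingPerm α (2 * n) π₂)
    (π₃ : Equiv.Perm (Fin (2 * n + 1))) (hπ₃ : IsOrderingPerm α (2 * n + 1) π₃) :
    Equiv.Perm.sign π₂ = Equiv.Perm.sign π₃ ∧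
      Equiv.Perm.sign π₂ = ∏ ℓ ∈ Finset.Icc 1 n, (-1 : ℤˣ) ^ ⌊(2 * ℓ : ℝ) * α⌋ := by
  rw [hπ₂.sign_eq_prod_range hα, hπ₃.sign_eq_prod_range hα]
  constructor
  · rw [Finset.prod_range_succ, pow_mul, Int.units_sq, one_pow, mul_one]
  · rw [prod_range_two_mul_pow fun k ↦ (-1 : ℤˣ) ^ ⌊(k : ℝ) * α⌋]
    simp
end

section
/- For every irrational α ∈ (0,1) and every positive integer n, M_n(α) = M_{π_{α,n}}. -/
/-- `eVec n m` is the standard basis column vector `e_m` of `ℤ^n` (1-based index `m`,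
with `e_{n+1} = 0`; indeed `eVec n m = 0` whenever `m = 0` or `m > n`). -/
def eVec (n : ℕ) (m : ℕ) : Fin n → ℤ := fun i => if (i : ℕ) + 1 = m then 1 else 0

/-- `deltaVec n m` is `δ_m = e_{m+1} - e_m` (1-based index `m`). -/
def deltaVec (n : ℕ) (m : ℕ) : Fin n → ℤ := eVec n (m + 1) - eVec n m

/-- `Dset σ` is the set `D(σ) = {1} ∪ {k : σ⁻¹(k−1) > σ⁻¹(k)}` of the paper, encoded
0-based: the element `i : Fin n` represents `k = i + 1` of `{1, …, n}`. -/
def Dset {n : ℕ} (σ : Equiv.Perm (Fin n)) : Finset (Fin n) :=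
  Finset.univ.filter fun i => (i : ℕ) = 0 ∨ σ⁻¹ i < σ⁻¹ ⟨(i : ℕ) - 1, lt_of_le_of_lt (Nat.sub_le _ _) i.isLt⟩

/-- `wVec σ j` is the vector `w^σ_{j+1}` of the paper (so `wVec σ 0 = w^σ_1` is the sum of
the `e_i` over `i ∈ D(σ)`, and `wVec σ j = wVec σ (j-1) + δ_{σ(j)}` for `1 ≤ j ≤ n`,
where the permutation of `{1, …, n}` is encoded 0-based as `σ : Equiv.Perm (Fin n)`). -/
def wVec {n : ℕ} (σ : Equiv.Perm (Fin n)) : ℕ → (Fin n → ℤ)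
  | 0 => ∑ i ∈ Dset σ, eVec n ((i : ℕ) + 1)
  | j + 1 => wVec σ j + (if h : j < n then deltaVec n ((σ ⟨j, h⟩ : ℕ) + 1) else 0)

/-- `Lmat σ` is the `n × (n+1)` matrix `L_σ` whose columns are `w^σ_1, …, w^σ_{n+1}`. -/
def Lmat {n : ℕ} (σ : Equiv.Perm (Fin n)) : Matrix (Fin n) (Fin (n + 1)) ℤ :=
  Matrix.of fun i j => wVec σ (j : ℕ) i

/-- `Mmat σ` is the `n × n` matrix `M_σ` whose `j`-th column is `w^σ_j - w^σ_{n+1}`. -/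
def Mmat {n : ℕ} (σ : Equiv.Perm (Fin n)) : Matrix (Fin n) (Fin n) ℤ :=
  Matrix.of fun i j => wVec σ (j : ℕ) i - wVec σ n i

/-- `Pmat σ` is the permutation matrix `P_σ = (p_{ij})`, `p_{ij} = ⟦j = σ(i)⟧`. -/
def Pmat {n : ℕ} (R : Type*) [Zero R] [One R] (σ : Equiv.Perm (Fin n)) :
    Matrix (Fin n) (Fin n) R :=
  Matrix.of fun i j => if j = σ i then 1 else 0

lemma lexLt_iff_toLex_lt {n : ℕ} (x y : Fin n → ℤ) : lexLt x y ↔ toLex x < toLex y := Iff.rfl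

/-- The closed form of the coordinates of `w^σ_{j+1}`. -/
lemma wVec_apply {n : ℕ} (σ : Equiv.Perm (Fin n)) (j : ℕ) (i p : Fin n)
    (hp : (p : ℕ) = (i : ℕ) - 1) :
    wVec σ j i = (if (i : ℕ) = 0 ∨ σ⁻¹ i < σ⁻¹ p then 1 else 0)
      + (if (i : ℕ) ≠ 0 ∧ ((σ⁻¹ p : Fin n) : ℕ) < j then 1 else 0)
      - (if ((σ⁻¹ i : Fin n) : ℕ) < j then 1 else 0) := by
  induction j with
  | zero =>
    obtain rfl : p = ⟨(i : ℕ) - 1, lt_of_le_of_lt (Nat.sub_le _ _) i.isLt⟩ := Fin.ext hp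
    simp [wVec, eVec, Dset, Finset.sum_apply, Fin.val_inj]
  | succ j ih =>
    rw [wVec, Pi.add_apply, ih]
    by_cases h : j < n
    · have key (q : Fin n) : ((σ⁻¹ q : Fin n) : ℕ) = j ↔ (q : ℕ) = σ ⟨j, h⟩ := by
        rw [Fin.val_inj, ← Equiv.Perm.inv_eq_iff_eq, Fin.ext_iff]
      have hi := key i
      have hq := key p
      simp only [h, dif_pos, deltaVec, eVec, Pi.sub_apply]
      generalize ((σ ⟨j, h⟩ : Fin n) : ℕ) = m at *
      generalize hc : (if (i : ℕ) = 0 ∨ σ⁻¹ i < σ⁻¹ p then (1 : ℤ) else 0) = c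
      clear hc
      split_ifs <;> omega
    · have h1 := (σ⁻¹ i).isLt
      have h2 := (σ⁻¹ p).isLt
      have e1 : ((σ⁻¹ i : Fin n) : ℕ) < j := by omega
      have e2 : ((σ⁻¹ p : Fin n) : ℕ) < j := by omega
      simp only [h, e1, e2, Nat.lt_succ_of_lt, dif_neg, not_false_eq_true, Pi.zero_apply, add_zero]

lemma lexLt_wVec_succ {n : ℕ} (σ : Equiv.Perm (Fin n)) {j : ℕ} (h : j < n) :
    lexLt (wVec σ (j + 1)) (wVec σ j) := by
  refine ⟨σ ⟨j, h⟩, fun l hl => ?_, ?_⟩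
  · have : (l : ℕ) < σ ⟨j, h⟩ := hl
    simp only [wVec, h, dif_pos, deltaVec, eVec, Pi.add_apply, Pi.sub_apply]
    split_ifs <;> omega
  · simp [wVec, h, deltaVec, eVec]

lemma strictAnti_toLex_wVec {n : ℕ} (σ : Equiv.Perm (Fin n)) :
    StrictAnti fun j : Fin (n + 1) => toLex (wVec σ j) :=
  Fin.strictAnti_iff_succ_lt.2 fun i =>
    (lexLt_iff_toLex_lt _ _).1 (lexLt_wVec_succ σ i.isLt)

lemma floor_add_eq_ite (x y : ℝ) :
    ⌊x + y⌋ = ⌊x⌋ + ⌊y⌋ + if Int.fract x + Int.fract y < 1 then 0 else 1 := by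
  rw [Int.floor_eq_iff]
  have hx := Int.floor_add_fract x
  have hy := Int.floor_add_fract y
  have := Int.fract_nonneg x
  have := Int.fract_nonneg y
  have := Int.fract_lt_one x
  have := Int.fract_lt_one y
  split_ifs <;> push_cast <;> constructor <;> linarith

lemma floor_add_eq_ite_fract {α : ℝ} (h0 : 0 < α) (h1 : α < 1) (y : ℝ) :
    ⌊y + α⌋ = ⌊y⌋ + if Int.fract (y + α) < Int.fract y then 1 else 0 := by
  have hα : Int.fract α = α := Int.fract_eq_self.2 ⟨h0.le, h1⟩
  have hf : ⌊α⌋ = 0 := Int.floor_eq_zero_iff.2 ⟨h0.le, h1⟩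
  have h := floor_add_eq_ite y α
  have h2 := Int.floor_add_fract (y + α)
  have h3 := Int.floor_add_fract y
  rw [h, hf] at h2 ⊢
  split_ifs at h2 ⊢ <;> push_cast at h2 <;> first | ring1 | (exfalso; linarith)

lemma exists_lt_iff_of_antitone {n : ℕ} (P : Fin n → Prop)
    (hP : ∀ k l : Fin n, k < l → P l → P k) :
    ∃ j : Fin (n + 1), ∀ k : Fin n, (k : ℕ) < j ↔ P k := by
  classical
  have hex : ∃ j : ℕ, ∀ h : j < n, ¬ P ⟨j, h⟩ := ⟨n, fun h => absurd h (lt_irrefl n)⟩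
  have hle : Nat.find hex ≤ n := Nat.find_min' hex fun h => absurd h (lt_irrefl n)
  refine ⟨⟨Nat.find hex, Nat.lt_succ_of_le hle⟩, fun k => ⟨fun hk => ?_, fun hk => ?_⟩⟩
  · have := Nat.find_min hex hk
    push Not at this
    exact this.2
  · by_contra hlt
    have hlt' : Nat.find hex ≤ k := not_lt.1 hlt
    have hn := hlt'.trans_lt k.isLt
    refine Nat.find_spec hex hn ?_
    rcases hlt'.eq_or_lt with h | h
    · convert hk
    · exact hP _ k h hk

/-- Every factor of length `n` of the characteristic word is one of the `w^π_j`. -/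
lemma charFactors_subset_range_wVec {α : ℝ} (h0 : 0 < α) (h1 : α < 1) {n : ℕ}
    (π : Equiv.Perm (Fin n)) (hπ : IsOrderingPerm α n π) :
    charFactors α n ⊆ Set.range fun j : Fin (n + 1) => wVec π j := by
  rintro v ⟨s, hs⟩
  set a : Fin n → ℝ := fun k => Int.fract (((k : ℕ) + 1 : ℝ) * α) with ha
  set x : ℝ := ((s : ℝ) + 1) * α with hx
  have hmono : StrictMono (a ∘ π) := fun k l hkl => hπ k l hkl
  obtain ⟨j, hj⟩ := exists_lt_iff_of_antitone (fun k => Int.fract x + a (π k) < 1)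
    fun k l hkl hl => by
      have : a (π k) < a (π l) := hmono hkl
      linarith
  have hj' (k : Fin n) : ((π⁻¹ k : Fin n) : ℕ) < j ↔ Int.fract x + a k < 1 := by
    simpa using hj (π⁻¹ k)
  have hlt (k l : Fin n) : π⁻¹ k < π⁻¹ l ↔ a k < a l := by
    simpa using (hmono.lt_iff_lt (a := π⁻¹ k) (b := π⁻¹ l)).symm
  refine ⟨j, funext fun i => ?_⟩
  obtain ⟨p, hp⟩ : ∃ p : Fin n, (p : ℕ) = (i : ℕ) - 1 :=
    ⟨⟨(i : ℕ) - 1, lt_of_le_of_lt (Nat.sub_le _ _) i.isLt⟩, rfl⟩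
  change wVec π j i = v i
  rw [hs i, wVec_apply π j i p hp]
  simp only [hj', hlt, charWord]
  have e1 : (((s + (i : ℕ) : ℕ) : ℝ) + 2) * α = x + ((i : ℕ) + 1 : ℝ) * α := by
    push_cast; ring
  have e2 : (((s + (i : ℕ) : ℕ) : ℝ) + 1) * α = x + ((i : ℕ) : ℝ) * α := by
    push_cast; ring
  have e3 : ((i : ℕ) + 1 : ℝ) * α = ((i : ℕ) : ℝ) * α + α := by ring
  have hstep := floor_add_eq_ite_fract h0 h1 (((i : ℕ) : ℝ) * α)
  rw [← e3] at hstep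
  rw [e1, e2, floor_add_eq_ite x, floor_add_eq_ite x, hstep]
  change _ = ⌊x⌋ + (_ + if Int.fract (((i : ℕ) + 1 : ℝ) * α) < _ then _ else _)
    + (if Int.fract x + a i < 1 then _ else _) - _
  rcases Nat.eq_zero_or_pos (i : ℕ) with hi | hi
  · have hf : ¬ Int.fract α < 0 := not_lt.2 (Int.fract_nonneg α)
    simp only [hi, Nat.cast_zero, zero_mul, zero_add, one_mul, Int.fract_zero, hf, add_zero,
      Int.fract_lt_one]
    simp
    split_ifs <;> omega
  · have hpi : ((i : ℕ) : ℝ) = (p : ℕ) + 1 := by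
      have : (i : ℕ) = p + 1 := by omega
      exact_mod_cast this
    have hp' : Int.fract (((i : ℕ) : ℝ) * α) = a p := by rw [hpi]
    rw [hp']
    change _ = ⌊x⌋ + (_ + if a i < a p then _ else _) + _ - _
    simp only [hi.ne', false_or, ne_eq, not_false_eq_true, true_and]
    split_ifs <;> omega

/-- For irrational `α ∈ (0,1)` and `n ≥ 1`: listing `F_n(α)` in anti-lexicographic
(lexicographically decreasing) order as `v_1, …, v_{n+1}`, the matrix `M_n(α)` whose
`j`-th column is `v_j − v_{n+1}` equals `M_{π_{α,n}}`. -/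
theorem charFactors_matrix_eq_Mmat (α : ℝ) (hα : Irrational α) (h0 : 0 < α) (h1 : α < 1)
    (n : ℕ) (hn : 0 < n) (v : Fin (n + 1) → (Fin n → ℤ))
    (hrange : Set.range v = charFactors α n)
    (hanti : ∀ i j : Fin (n + 1), i < j → lexLt (v j) (v i))
    (π : Equiv.Perm (Fin n)) (hπ : IsOrderingPerm α n π) :
    Matrix.of (fun i j : Fin n => v (Fin.castSucc j) i - v (Fin.last n) i) = Mmat π := by
  have hv : StrictAnti fun j => toLex (v j) := fun i j hij =>
    (lexLt_iff_toLex_lt _ _).1 (hanti i j hij)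
  have hw := strictAnti_toLex_wVec π
  have hinj : Function.Injective v := fun i j hij => hv.injective (congrArg toLex hij)
  have hsub : Set.range v ⊆ Set.range fun j : Fin (n + 1) => wVec π j :=
    hrange ▸ charFactors_subset_range_wVec h0 h1 π hπ
  have heq : Set.range v = Set.range fun j : Fin (n + 1) => wVec π j := by
    refine Set.eq_of_subset_of_ncard_le hsub ?_ (Set.finite_range _)
    rw [Set.ncard_range_of_injective hinj, ← Set.image_univ]
    simpa [Set.ncard_univ] using Set.ncard_image_le (f := fun j : Fin (n + 1) => wVec π j)
      (Set.finite_univ)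
  have hvw : v = fun j : Fin (n + 1) => wVec π j := by
    have hr : Set.range (fun j => OrderDual.toDual (toLex (v j)))
        = Set.range fun j : Fin (n + 1) => OrderDual.toDual (toLex (wVec π j)) := by
      have := congrArg (Set.image fun y => OrderDual.toDual (toLex y)) heq
      simpa only [← Set.range_comp, Function.comp_def] using this
    have := (StrictMono.range_inj hv.dual_right hw.dual_right).1 hr
    exact this
  subst hvw
  ext i j
  simp [Mmat]
end

section
/- For every n and every k with 2 ≤ k ≤ n, M_{(k,k−1)} = I + V_k, where (k,k−1) denotes the transposition of {1, …, n} swapping k and k−1, I is the n×n identity matrix, and V_k is the n×n matrix all of whose entries are 0 except for its k-th column, which equals e_{k−1} − 2e_k + e_{k+1}. -/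
theorem eVec_succ_self (n : ℕ) : eVec n (n + 1) = 0 := by
  ext i
  have := i.isLt
  simp only [eVec, Pi.zero_apply, ite_eq_right_iff]
  omega

theorem wVec_succ {n : ℕ} (σ : Equiv.Perm (Fin n)) {j : ℕ} (h : j < n) :
    wVec σ (j + 1) = wVec σ j + deltaVec n ((σ ⟨j, h⟩ : ℕ) + 1) := by
  simp [wVec, h]

theorem wVec_swap_sub {n a : ℕ} (ha : a + 1 < n) {σ : Equiv.Perm (Fin n)}
    (hσ : σ = Equiv.swap ⟨a + 1, ha⟩ ⟨a, by omega⟩) {j : ℕ} (hj : j ≤ n) :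
    wVec σ j - wVec σ n =
      eVec n (j + 1) +
        (if j = a + 1 then deltaVec n (a + 2) - deltaVec n (a + 1) else 0) := by
  induction hj using Nat.decreasingInduction with
  | self => simp [eVec_succ_self, show n ≠ a + 1 by omega]
  | of_succ j hj ih =>
    rw [wVec_succ σ hj, add_sub_right_comm, ← eq_sub_iff_add_eq] at ih
    rw [ih]
    rcases eq_or_ne j (a + 1) with rfl | h1
    · have : (σ ⟨a + 1, hj⟩ : ℕ) = a := by simp [hσ]
      simp only [this, deltaVec, if_true, show a + 1 + 1 ≠ a + 1 by omega, if_false]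
      abel
    rcases eq_or_ne j a with rfl | h2
    · have : (σ ⟨j, hj⟩ : ℕ) = j + 1 := by simp [hσ]
      simp only [this, deltaVec, if_true, h1, if_false]
      abel
    · have : (σ ⟨j, hj⟩ : ℕ) = j := by
        rw [hσ, Equiv.swap_apply_of_ne_of_ne] <;> simp [h1, h2]
      simp only [this, deltaVec, h1, show j + 1 ≠ a + 1 by omega, if_false]
      abel

/-- For `2 ≤ k ≤ n`, `M_{(k,k-1)} = I + V_k`, where `(k,k-1)` is the transposition of
`{1, …, n}` swapping `k` and `k-1` (encoded 0-based as the swap of `k-1` and `k-2` in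
`Fin n`), and `V_k` is the matrix which is zero except for its `k`-th column, which is
`e_{k-1} - 2e_k + e_{k+1}`. -/
theorem Mmat_adjacent_transposition (n k : ℕ) (h2 : 2 ≤ k) (hk : k ≤ n) :
    Mmat (Equiv.swap (⟨k - 1, by omega⟩ : Fin n) ⟨k - 2, by omega⟩) =
      1 + Matrix.of (fun i j : Fin n =>
        if (j : ℕ) + 1 = k then eVec n (k - 1) i - 2 * eVec n k i + eVec n (k + 1) i
        else 0) := by
  obtain ⟨a, rfl⟩ := Nat.exists_eq_add_of_le' h2
  ext i j
  have h := congrFun (wVec_swap_sub (n := n) (a := a) (by omega) rfl j.isLt.le) i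
  refine h.trans ?_
  have h_one : eVec n ((j : ℕ) + 1) i = (1 : Matrix (Fin n) (Fin n) ℤ) i j := by
    simp [eVec, Matrix.one_apply, Fin.ext_iff]
  rw [Pi.add_apply, h_one, Matrix.add_apply, Matrix.of_apply]
  by_cases hj : (j : ℕ) = a + 1
  · simp only [hj, if_true, deltaVec, Pi.sub_apply,
      show a + 2 - 1 = a + 1 by omega]
    ring
  · simp [hj]
end

section
/- (Sós) Let α be an irrational real number, n a positive integer, and write π = π_{α,n}. Then for every k with 1 ≤ k < n, π(k+1) = π(k) + π(1)·⟦π(k) ≤ π(n)⟧ − π(n)·⟦n < π(1) + π(k)⟧, where ⟦Q⟧ equals 1 if the condition Q holds and 0 otherwise. -/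
theorem fract_int_add_mul (α : ℝ) (i j : ℤ) :
    Int.fract (((i + j : ℤ) : ℝ) * α) = Int.fract ((i : ℝ) * α) + Int.fract ((j : ℝ) * α) ∨
      Int.fract (((i + j : ℤ) : ℝ) * α) =
        Int.fract ((i : ℝ) * α) + Int.fract ((j : ℝ) * α) - 1 := by
  have key : ((i + j : ℤ) : ℝ) * α = i * α + j * α := by push_cast; ring
  rw [key]
  have h0 := Int.fract_nonneg ((i : ℝ) * α)
  have h1 := Int.fract_lt_one ((i : ℝ) * α)
  have h2 := Int.fract_nonneg ((j : ℝ) * α)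
  have h3 := Int.fract_lt_one ((j : ℝ) * α)
  rcases lt_or_ge (Int.fract ((i : ℝ) * α) + Int.fract ((j : ℝ) * α)) 1 with h | h
  · left
    rw [Int.fract_eq_iff]
    refine ⟨by linarith, h, ⌊(i : ℝ) * α⌋ + ⌊(j : ℝ) * α⌋, ?_⟩
    simp only [Int.fract]
    push_cast
    ring
  · right
    rw [Int.fract_eq_iff]
    refine ⟨by linarith, by linarith, ⌊(i : ℝ) * α⌋ + ⌊(j : ℝ) * α⌋ + 1, ?_⟩
    simp only [Int.fract]
    push_cast
    ring

/-- Let `f : ℤ → [0, 1)` be additive modulo `1`, with strict minimum over `{1, …, n}` at `a` and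
strict maximum at `b`. Then the element of `{1, …, n}` whose value under `f` comes next after
that of `x ≠ b` is `x + a` if `x + a ≤ n`, is `x - b` if `b < x`, and is `x + a - b` otherwise. -/
theorem exists_next_of_additive_mod_one (f : ℤ → ℝ) (f_nonneg : ∀ i, 0 ≤ f i)
    (f_lt_one : ∀ i, f i < 1)
    (f_add : ∀ i j, f (i + j) = f i + f j ∨ f (i + j) = f i + f j - 1)
    (n a b x : ℤ) (ha : 1 ≤ a) (han : a ≤ n) (hb : 1 ≤ b) (hbn : b ≤ n) (hx : 1 ≤ x)
    (hxn : x ≤ n) (hab : a ≠ b) (hxb : x ≠ b)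
    (ha_pos : 0 < f a) (hmin : ∀ j, 1 ≤ j → j ≤ n → j ≠ a → f a < f j)
    (hmax : ∀ j, 1 ≤ j → j ≤ n → j ≠ b → f j < f b) :
    ∃ z, z = x + a * (if x ≤ b then 1 else 0) - b * (if n < a + x then 1 else 0) ∧
      1 ≤ z ∧ z ≤ n ∧ f x < f z ∧ ∀ w, 1 ≤ w → w ≤ n → f x < f w → f z ≤ f w := by
  have f_sub : ∀ i j, f (i - j) = f i - f j ∨ f (i - j) = f i - f j + 1 := by
    intro i j
    rcases f_add (i - j) j with h | h <;> rw [sub_add_cancel] at h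
    · left; linarith
    · right; linarith
  have hmin' : ∀ j, 1 ≤ j → j ≤ n → f a ≤ f j := by
    intro j h1 h2
    rcases eq_or_ne j a with rfl | h
    · exact le_rfl
    · exact (hmin j h1 h2 h).le
  have hmax' : ∀ j, 1 ≤ j → j ≤ n → f j ≤ f b := by
    intro j h1 h2
    rcases eq_or_ne j b with rfl | h
    · exact le_rfl
    · exact (hmax j h1 h2 h).le
  have hsum : n < a + b := by
    by_contra! hle
    have h1 := hmin (a + b) (by omega) hle (by omega)
    have h2 := hmax (a + b) (by omega) hle (by omega)
    have h3 := f_lt_one b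
    rcases f_add a b with h | h <;> linarith
  have hxltb : f x < f b := hmax x hx hxn hxb
  have hb1 := f_lt_one b
  rcases le_or_gt (a + x) n with hax | hax
  · refine ⟨x + a, by rw [if_pos (by omega), if_neg (by omega)]; ring, by omega, by omega, ?_⟩
    have hz : f (x + a) = f x + f a := by
      have := hmin' (x + a) (by omega) (by omega)
      rcases f_add x a with h | h <;> linarith
    refine ⟨by linarith, fun w hw hwn hxw => ?_⟩
    · by_contra! hlt
      rcases lt_trichotomy w x with h | rfl | h
      · have h1 : f (x - w) = f x - f w + 1 := by
          have := f_nonneg (x - w)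
          rcases f_sub x w with h | h <;> linarith
        have h2 := hmin' (x - w + a) (by omega) (by omega)
        have h3 := f_lt_one (x - w + a)
        rcases f_add (x - w) a with h | h <;> linarith
      · exact lt_irrefl _ hxw
      · have h1 := hmin' (w - x) (by omega) (by omega)
        have h2 := f_lt_one (w - x)
        rcases f_sub w x with h | h <;> linarith
  rcases lt_or_gt_of_ne hxb with hlt | hgt
  · refine ⟨x + a - b, by rw [if_pos (by omega), if_pos (by omega)]; ring, by omega, by omega, ?_⟩
    have hd : f a < f b - f x := by
      have h1 := hmin (b - x) (by omega) (by omega) (by omega)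
      have h2 := f_lt_one (b - x)
      rcases f_sub b x with h | h <;> linarith
    have hz : f (x + a - b) = f x + f a - f b + 1 := by
      have h1 := f_nonneg (x + a - b)
      rcases f_add x a with h | h <;> rcases f_sub (x + a) b with h' | h' <;> linarith
    refine ⟨by linarith, fun w hw hwn hxw => ?_⟩
    by_contra! hwz
    rcases lt_trichotomy w x with h | rfl | h
    · have h1 : f (x - w) = f x - f w + 1 := by
        have := f_nonneg (x - w)
        rcases f_sub x w with h | h <;> linarith
      have h2 := hmin' (b - (x - w)) (by omega) (by omega)
      have h3 := hmax (x - w) (by omega) (by omega) (by omega)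
      have h4 := f_lt_one (b - (x - w))
      rcases f_sub b (x - w) with h | h <;> linarith
    · exact lt_irrefl _ hxw
    · have h1 : f (w - x) = f w - f x := by
        have := f_lt_one (w - x)
        rcases f_sub w x with h | h <;> linarith
      have h2 := hmin (w - x) (by omega) (by omega) (by omega)
      have h3 := hmax' (a - (w - x)) (by omega) (by omega)
      have h4 := f_nonneg (a - (w - x))
      rcases f_sub a (w - x) with h | h <;> linarith
  · refine ⟨x - b, by rw [if_neg (by omega), if_pos (by omega)]; ring, by omega, by omega, ?_⟩
    have hz : f (x - b) = f x - f b + 1 := by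
      have h1 := f_nonneg (x - b)
      rcases f_sub x b with h | h <;> linarith
    refine ⟨by linarith, fun w hw hwn hxw => ?_⟩
    by_contra! hwz
    rcases lt_trichotomy w x with h | rfl | h
    · have h1 := hmax' (x - w) (by omega) (by omega)
      have h2 := f_nonneg (x - w)
      rcases f_sub x w with h | h <;> linarith
    · exact lt_irrefl _ hxw
    · have h1 : f (w - x) = f w - f x := by
        have := f_lt_one (w - x)
        rcases f_sub w x with h | h <;> linarith
      have h2 := hmax' (w - x + b) (by omega) (by omega)
      have h3 := f_nonneg (w - x + b)
      rcases f_add (w - x) b with h | h <;> linarith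

/-- (Sós) If `π = π_{α,n}`, then for `1 ≤ k < n`,
`π(k+1) = π(k) + π(1)·⟦π(k) ≤ π(n)⟧ − π(n)·⟦n < π(1) + π(k)⟧`
(1-based positions and values; position `k` of `{1, …, n}` is `Fin`-index `k-1`, and the
value at it is the `Fin`-value plus `1`). -/
theorem sos_recursion (α : ℝ) (hα : Irrational α) (n : ℕ)
    (π : Equiv.Perm (Fin n)) (hπ : IsOrderingPerm α n π)
    (k : ℕ) (h1 : 1 ≤ k) (h2 : k < n) :
    ((π ⟨k, h2⟩ : ℕ) : ℤ) + 1 =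
      (((π ⟨k - 1, by omega⟩ : ℕ) : ℤ) + 1) +
        (((π ⟨0, by omega⟩ : ℕ) : ℤ) + 1) *
          (if (π ⟨k - 1, by omega⟩ : ℕ) + 1 ≤ (π ⟨n - 1, by omega⟩ : ℕ) + 1 then 1 else 0) -
        (((π ⟨n - 1, by omega⟩ : ℕ) : ℤ) + 1) *
          (if n < ((π ⟨0, by omega⟩ : ℕ) + 1) + ((π ⟨k - 1, by omega⟩ : ℕ) + 1)
            then 1 else 0) := by
  set g : ℤ → ℝ := fun i => Int.fract ((i : ℝ) * α) with hg
  have hπ' : ∀ i j : Fin n, i < j → g ((π i : ℕ) + 1) < g ((π j : ℕ) + 1) := by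
    intro i j hij
    simpa [hg] using hπ i j hij
  have hsurj : ∀ j : ℤ, 1 ≤ j → j ≤ n → ∃ i : Fin n, ((π i : ℕ) : ℤ) + 1 = j := by
    intro j hj hjn
    refine ⟨π.symm ⟨(j - 1).toNat, by omega⟩, ?_⟩
    rw [Equiv.apply_symm_apply]
    simp only
    omega
  have hne : ∀ i j : Fin n, (i : ℕ) ≠ j → ((π i : ℕ) : ℤ) + 1 ≠ ((π j : ℕ) : ℤ) + 1 := by
    intro i j hij h
    exact hij (congrArg Fin.val (π.injective (Fin.ext (by omega : (π i : ℕ) = π j))))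
  have hpos : 0 < g (((π ⟨0, by omega⟩ : ℕ) : ℤ) + 1) := by
    refine Int.fract_pos.2 fun h => ?_
    have hirr : Irrational (((((π ⟨0, by omega⟩ : ℕ) : ℤ) + 1 : ℤ) : ℝ) * α) :=
      hα.intCast_mul (by omega)
    exact hirr.ne_int _ h
  obtain ⟨z, hz, hz1, hzn, hxz, hnext⟩ := exists_next_of_additive_mod_one g
    (fun _ => Int.fract_nonneg _) (fun _ => Int.fract_lt_one _) (fract_int_add_mul α) n
    ((π ⟨0, by omega⟩ : ℕ) + 1) ((π ⟨n - 1, by omega⟩ : ℕ) + 1) ((π ⟨k - 1, by omega⟩ : ℕ) + 1)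
    (by omega) (by omega) (by omega) (by omega) (by omega) (by omega)
    (hne _ _ (by simp only; omega)) (hne _ _ (by simp only; omega)) hpos
    (by
      intro j hj hjn hja
      obtain ⟨i, rfl⟩ := hsurj j hj hjn
      refine hπ' _ _ (Fin.lt_def.2 (Nat.pos_of_ne_zero fun h => hja ?_))
      rw [show i = ⟨0, by omega⟩ from Fin.ext h])
    (by
      intro j hj hjn hjb
      obtain ⟨i, rfl⟩ := hsurj j hj hjn
      refine hπ' _ _ (lt_of_le_of_ne (Fin.le_def.2 (by simp only; omega)) fun h => hjb ?_)
      rw [h])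
  obtain ⟨m, rfl⟩ := hsurj z hz1 hzn
  have hle := hnext ((π ⟨k, h2⟩ : ℕ) + 1) (by omega) (by omega)
    (hπ' _ _ (Fin.lt_def.2 (by simp only; omega)))
  have hmk : m = ⟨k, h2⟩ := by
    refine le_antisymm (not_lt.1 fun h => absurd (hπ' _ _ h) hle.not_gt) (not_lt.1 fun h => ?_)
    have hm : m ≤ ⟨k - 1, by omega⟩ := Fin.le_def.2 (Nat.le_sub_one_of_lt (Fin.lt_def.1 h))
    rcases hm.eq_or_lt with h' | h'
    · rw [h'] at hxz
      exact lt_irrefl _ hxz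
    · exact lt_asymm hxz (hπ' _ _ h')
  rw [← hmk, hz]
  norm_cast
end

section
/- Let α be an irrational real number and n ≥ 2 an integer. If π_{α,n}(n) = n, then π_{α,n}(1) is coprime to n and ord(π_{α,n−1}) = ord(π_{α,n}) = the multiplicative order of π_{α,n}(1) modulo n. -/
/-- If `σ` acts on `{1, …, N}` as multiplication by `r` modulo `n`, where `N ≤ n`, then `σ` and `r`
have the same order. -/
theorem orderOf_perm_eq_of_mul_zmod {n N : ℕ} (hN : 0 < N) (hNn : N ≤ n)
    (σ : Equiv.Perm (Fin N)) (r : ZMod n)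
    (h : ∀ k, (((σ k : ℕ) + 1 : ℕ) : ZMod n) = r * (((k : ℕ) + 1 : ℕ) : ZMod n)) :
    orderOf σ = orderOf r := by
  have hpow (t : ℕ) (k : Fin N) :
      ((((σ ^ t) k : ℕ) + 1 : ℕ) : ZMod n) = r ^ t * (((k : ℕ) + 1 : ℕ) : ZMod n) := by
    induction t with
    | zero => simp
    | succ t ih => rw [pow_succ', Equiv.Perm.mul_apply, h, ih, pow_succ', mul_assoc]
  refine orderOf_eq_orderOf_iff.mpr fun t => ⟨fun ht => ?_, fun ht => ?_⟩
  · simpa [ht] using (hpow t ⟨0, hN⟩).symm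
  · ext k
    have hk := hpow t k
    rw [ht, one_mul, ZMod.natCast_eq_natCast_iff] at hk
    exact (Nat.ModEq.add_right_cancel' 1 hk).eq_of_lt_of_lt
      (((σ ^ t) k).isLt.trans_le hNn) (k.isLt.trans_le hNn)

/-- If `{nα}` exceeds `{dα}` for `0 < d < n`, no fraction with denominator `d` lies in
`(α, (⌊nα⌋ + 1) / n]`. -/
theorem mul_floor_add_one_lt {α : ℝ} {n : ℕ}
    (hmax : ∀ i : ℤ, 0 < i → i < n → Int.fract (i * α) < Int.fract (n * α))
    {d b : ℤ} (hd : 0 < d) (hdn : d < n) (hb : d * α < b) :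
    d * (⌊n * α⌋ + 1) < b * n := by
  by_contra! hle
  have hfloor : (⌊d * α⌋ : ℝ) ≤ b - 1 := by
    exact_mod_cast Int.le_sub_one_of_lt (Int.floor_lt.mpr hb)
  have hlt := hmax d hd hdn
  rw [Int.fract, Int.fract] at hlt
  have hpos := Int.lt_floor_add_one (n * α)
  have hle' : (b : ℝ) * n ≤ d * (⌊n * α⌋ + 1) := by exact_mod_cast hle
  have hd' : (0 : ℝ) < d := by exact_mod_cast hd
  have hdn' : (d : ℝ) < n := by exact_mod_cast hdn
  have hgap : (⌊n * α⌋ : ℝ) + 1 - n * α < b - d * α := by linarith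
  nlinarith

/-- If `{nα}` exceeds `{iα}` for `0 < i < n` and `f` lists `{1, …, n - 1}` by increasing fractional
part, then `f` inverts multiplication by `⌊nα⌋ + 1` modulo `n`. -/
theorem mul_floor_add_one_zmod_eq {α : ℝ} {n : ℕ}
    (hmax : ∀ i : ℤ, 0 < i → i < n → Int.fract (i * α) < Int.fract (n * α))
    (f : Fin (n - 1) → ℤ) (hf0 : ∀ k, 0 < f k) (hfn : ∀ k, f k < n)
    (hf : StrictMono fun k => Int.fract (f k * α)) (k : Fin (n - 1)) :
    (f k : ZMod n) * ((⌊n * α⌋ + 1 : ℤ) : ZMod n) = (((k : ℕ) + 1 : ℕ) : ZMod n) := by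
  have hα : (n : ℝ) * α < (⌊n * α⌋ + 1 : ℤ) := by
    exact_mod_cast Int.lt_floor_add_one (n * α)
  have hK (d b : ℤ) (hd : 0 < d) (hdn : d < n) (hb : d * α < b) :
      d * (⌊n * α⌋ + 1) < b * n := mul_floor_add_one_lt hmax hd hdn hb
  generalize ⌊n * α⌋ + 1 = m at *
  have hn (l : Fin (n - 1)) : (0 : ℝ) < n := by
    have := l.isLt
    exact_mod_cast (by omega : 0 < n)
  have hK' (d b : ℤ) (hd : 0 < d) (hn : (0 : ℝ) < n) (hb : b ≤ d * α) : b * n < d * m := by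
    have hd' : (0 : ℝ) < d := by exact_mod_cast hd
    have : (b : ℝ) * n < d * m := by nlinarith
    exact_mod_cast this
  let g (l : Fin (n - 1)) : ℤ := f l * m - ⌊f l * α⌋ * n
  have hg0 (l) : 0 < g l := by
    have := hK' (f l) _ (hf0 l) (hn l) (Int.floor_le _)
    simp only [g]; linarith
  have hgn (l) : g l < n := by
    have := hK (f l) (⌊f l * α⌋ + 1) (hf0 l) (hfn l)
      (by exact_mod_cast Int.lt_floor_add_one (f l * α))
    simp only [g]; linarith
  have hg : StrictMono g := by
    intro a b hab
    have hlt := hf hab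
    simp only [Int.fract] at hlt
    rcases lt_trichotomy (f a) (f b) with h | h | h
    · have := hK' (f b - f a) (⌊f b * α⌋ - ⌊f a * α⌋) (by linarith) (hn a)
        (by push_cast; linarith)
      simp only [g]; linarith
    · simp [h] at hlt
    · have := hK (f a - f b) (⌊f a * α⌋ - ⌊f b * α⌋) (by linarith)
        (by linarith [hfn a, hf0 b]) (by push_cast; linarith)
      simp only [g]; linarith
  let G (l : Fin (n - 1)) : Fin (n - 1) :=
    ⟨(g l - 1).toNat, by have := hg0 l; have := hgn l; omega⟩
  have hG : StrictMono G := by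
    intro a b hab
    have := hg hab
    have := hg0 a
    simp only [G, Fin.mk_lt_mk]
    omega
  have hGk : G k = k := le_antisymm hG.apply_le hG.le_apply
  have hgk : g k = ((k : ℕ) + 1 : ℕ) := by
    have := congrArg Fin.val hGk
    simp only [G] at this
    have := hg0 k
    omega
  have := congrArg (Int.cast : ℤ → ZMod n) hgk
  simpa [g] using this

/-- If `π_{α,n}(n) = n` (with `n ≥ 2`), then `π_{α,n}(1)` is coprime to `n` and
`ord(π_{α,n-1}) = ord(π_{α,n})` equals the multiplicative order of `π_{α,n}(1)` mod `n`. -/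
theorem order_of_orderingPerm_fixed_last (α : ℝ) (hα : Irrational α) (n : ℕ) (hn : 2 ≤ n)
    (π : Equiv.Perm (Fin n)) (hπ : IsOrderingPerm α n π)
    (π' : Equiv.Perm (Fin (n - 1))) (hπ' : IsOrderingPerm α (n - 1) π')
    (hlast : π ⟨n - 1, by omega⟩ = ⟨n - 1, by omega⟩) :
    Nat.Coprime ((π ⟨0, by omega⟩ : ℕ) + 1) n ∧
      orderOf π' = orderOf π ∧
      orderOf π = orderOf ((((π ⟨0, by omega⟩ : ℕ) + 1 : ℕ) : ZMod n)) := by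
  have hmax (i : ℤ) (hi : 0 < i) (hin : i < n) : Int.fract (i * α) < Int.fract (n * α) := by
    have hne : π.symm ⟨(i - 1).toNat, by omega⟩ ≠ ⟨n - 1, by omega⟩ := by
      intro h
      rw [Equiv.symm_apply_eq, hlast, Fin.mk.injEq] at h
      omega
    have hlt : π.symm ⟨(i - 1).toNat, by omega⟩ < ⟨n - 1, by omega⟩ := by
      have := Fin.val_ne_of_ne hne
      rw [Fin.lt_def]
      simp only at this ⊢
      omega
    have h := hπ _ _ hlt
    rw [hlast, Equiv.apply_symm_apply] at h
    have hi' : (((i - 1).toNat : ℝ) + 1) = i := by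
      exact_mod_cast (by omega : (((i - 1).toNat : ℤ) + 1) = i)
    have hn' : (((n - 1 : ℕ) : ℝ) + 1) = n := by
      exact_mod_cast (by omega : n - 1 + 1 = n)
    simpa only [hi', hn'] using h
  set m : ZMod n := ((⌊n * α⌋ + 1 : ℤ) : ZMod n) with hm
  have hmul (k : Fin n) : (((π k : ℕ) + 1 : ℕ) : ZMod n) * m = (((k : ℕ) + 1 : ℕ) : ZMod n) := by
    by_cases hk : k = ⟨n - 1, by omega⟩
    · subst hk
      rw [hlast]
      simp only [Nat.sub_add_cancel (by omega : 1 ≤ n), ZMod.natCast_self, zero_mul]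
    · have hkn : (k : ℕ) < n - 1 := by
        have := Fin.val_ne_of_ne hk
        simp only at this
        omega
      have := mul_floor_add_one_zmod_eq hmax
        (fun l : Fin (n - 1) => ((π ⟨l, by omega⟩ : ℕ) + 1 : ℤ)) (fun l => by positivity)
        (fun l => by
          have hl := π.injective.ne (a₁ := ⟨l, by omega⟩) (a₂ := ⟨n - 1, by omega⟩)
            (by rw [Ne, Fin.mk.injEq]; omega)
          rw [hlast] at hl
          have := Fin.val_ne_of_ne hl
          simp only at this
          omega)
        (fun a b hab => by
          have := hπ ⟨a, by omega⟩ ⟨b, by omega⟩ hab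
          simpa using this) ⟨k, hkn⟩
      simpa [hm] using this
  have hmul' (k : Fin (n - 1)) :
      (((π' k : ℕ) + 1 : ℕ) : ZMod n) * m = (((k : ℕ) + 1 : ℕ) : ZMod n) := by
    have := mul_floor_add_one_zmod_eq hmax
      (fun l : Fin (n - 1) => ((π' l : ℕ) + 1 : ℤ)) (fun l => by positivity)
      (fun l => by omega)
      (fun a b hab => by simpa using hπ' a b hab) k
    simpa [hm] using this
  set r : ℕ := (π ⟨0, by omega⟩ : ℕ) + 1
  have hrm : (r : ZMod n) * m = 1 := by simpa [r] using hmul ⟨0, by omega⟩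
  have hsolve {x y : ZMod n} (h : x * m = y) : x = r * y := by
    rw [← h, mul_left_comm, hrm, mul_one]
  have hπr := orderOf_perm_eq_of_mul_zmod (by omega) le_rfl π (r : ZMod n)
    fun k => hsolve (hmul k)
  have hπr' := orderOf_perm_eq_of_mul_zmod (by omega) (Nat.sub_le n 1) π' (r : ZMod n)
    fun k => hsolve (hmul' k)
  exact ⟨(ZMod.isUnit_iff_coprime r n).mp (IsUnit.of_mul_eq_one m hrm), hπr'.trans hπr.symm, hπr⟩
end

section
/- Let α be an irrational real number and n ≥ 2 an integer with π_{α,n}(1) = n, and let g be the least positive integer such that g divides π_{α,n}(n) + 1 and gcd(n, (π_{α,n}(n) + 1)/g) = 1. Then ord(π_{α,n−1}) equals the multiplicative order of −π_{α,n}(n) modulo n, and ord(π_{α,n}) equals the multiplicative order of −π_{α,n}(n) modulo g·n. -/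
theorem eq_succ_of_injOn_of_lt {m : ℕ} {f : ℕ → ℕ} (hlt : ∀ i < m, i < f i)
    (hle : ∀ i < m, f i ≤ m) (hinj : Set.InjOn f (Set.Iio m)) : ∀ i < m, f i = i + 1 := by
  suffices h : ∀ k i, i + k + 1 = m → f i = i + 1 from
    fun i hi => h (m - 1 - i) i (by omega)
  intro k
  induction k using Nat.strong_induction_on with
  | _ k ih =>
    intro i hi
    have h1 := hlt i (by omega)
    have h2 := hle i (by omega)
    by_contra hne
    have h3 := ih (m - f i) (by omega) (f i - 1) (by omega)
    have h4 : f i - 1 = i :=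
      hinj (show f i - 1 < m by omega) (show i < m by omega) (by omega)
    omega

theorem fract_lt_fract_sub {a b : ℝ} (h : Int.fract a < Int.fract b) :
    Int.fract a < Int.fract (a - b) := by
  have hb := Int.fract_lt_one b
  have ha := Int.fract_nonneg a
  have : Int.fract (a - b) = Int.fract a - Int.fract b + 1 := by
    rw [Int.fract_eq_iff]
    refine ⟨by linarith, by linarith, ⌊a⌋ - ⌊b⌋ - 1, ?_⟩
    push_cast
    linarith [Int.floor_add_fract a, Int.floor_add_fract b]
  linarith

theorem fract_lt_fract_add_sub {a b c : ℝ} (h : Int.fract a < Int.fract b)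
    (hc : Int.fract c < Int.fract (b - a)) : Int.fract a < Int.fract (a + c - b) := by
  have hb := Int.fract_lt_one b
  have ha := Int.fract_nonneg a
  have hc0 := Int.fract_nonneg c
  have hba : Int.fract (b - a) = Int.fract b - Int.fract a := by
    rw [Int.fract_eq_iff]
    refine ⟨by linarith, by linarith, ⌊b⌋ - ⌊a⌋, ?_⟩
    push_cast
    linarith [Int.floor_add_fract a, Int.floor_add_fract b]
  have : Int.fract (a + c - b) = Int.fract a + Int.fract c - Int.fract b + 1 := by
    rw [Int.fract_eq_iff]
    refine ⟨by linarith, by linarith, ⌊a⌋ + ⌊c⌋ - ⌊b⌋ - 1, ?_⟩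
    push_cast
    linarith [Int.floor_add_fract a, Int.floor_add_fract b, Int.floor_add_fract c]
  linarith

namespace IsOrderingPerm

variable {α : ℝ}

theorem lt_iff {n : ℕ} {π : Equiv.Perm (Fin n)} (hπ : IsOrderingPerm α n π) {k l : Fin n} :
    Int.fract (((π k : ℕ) + 1 : ℝ) * α) < Int.fract (((π l : ℕ) + 1 : ℝ) * α) ↔ k < l :=
  (show StrictMono fun k : Fin n => Int.fract (((π k : ℕ) + 1 : ℝ) * α) from
    fun k l h => hπ k l h).lt_iff_lt

theorem fract_lt_iff {n : ℕ} {π : Equiv.Perm (Fin n)} (hπ : IsOrderingPerm α n π)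
    {x y : Fin n} :
    Int.fract (((x : ℕ) + 1 : ℝ) * α) < Int.fract (((y : ℕ) + 1 : ℝ) * α) ↔
      π.symm x < π.symm y := by
  simpa using hπ.lt_iff (k := π.symm x) (l := π.symm y)

/-- Every `x ≠ π (last m)` has an element congruent to `x - (π (last m) + 1)` modulo `m + 1`
strictly later in the ordering, provided `m + 1` comes first. -/
theorem exists_symm_lt {m : ℕ} {π : Equiv.Perm (Fin (m + 1))}
    (hπ : IsOrderingPerm α (m + 1) π) (hfirst : π 0 = Fin.last m) {x : Fin (m + 1)}
    (hx : x ≠ π (Fin.last m)) :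
    ∃ y : Fin (m + 1), π.symm x < π.symm y ∧
      ((y : ℕ) : ZMod (m + 1)) = (x : ℕ) - (((π (Fin.last m) : ℕ) + 1 : ℕ) : ZMod (m + 1)) := by
  set q := π (Fin.last m) with hq
  have hxq : Int.fract (((x : ℕ) + 1 : ℝ) * α) < Int.fract (((q : ℕ) + 1 : ℝ) * α) := by
    rw [hπ.fract_lt_iff, hq, Equiv.symm_apply_apply]
    exact Fin.lt_last_iff_ne_last.2 fun h => hx (by rw [hq, ← h, Equiv.apply_symm_apply])
  rcases lt_or_gt_of_ne (Fin.val_ne_of_ne hx) with h | h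
  · refine ⟨⟨x + m - q, by omega⟩, ?_, ?_⟩
    · rw [← hπ.fract_lt_iff]
      have h1 : Int.fract (((Fin.last m : ℕ) + 1 : ℝ) * α) <
          Int.fract ((((⟨q - x - 1, by omega⟩ : Fin (m + 1)) : ℕ) + 1 : ℝ) * α) := by
        rw [hπ.fract_lt_iff, ← hfirst, Equiv.symm_apply_apply, Fin.pos_iff_ne_zero, Ne,
          Equiv.symm_apply_eq, hfirst, Fin.ext_iff]
        simp only [Fin.val_last]
        omega
      have h2 := fract_lt_fract_add_sub hxq (c := ((Fin.last m : ℕ) + 1 : ℝ) * α) (by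
        convert h1 using 2
        simp only [Nat.sub_sub]
        rw [Nat.cast_sub (by omega)]
        push_cast
        ring)
      convert h2 using 2
      simp only [Fin.val_last]
      rw [Nat.cast_sub (by omega)]
      push_cast
      ring
    · have h0 : ((m : ZMod (m + 1)) + 1) = 0 := by exact_mod_cast ZMod.natCast_self (m + 1)
      simp only
      rw [Nat.cast_sub (by omega)]
      push_cast
      linear_combination h0
  · refine ⟨⟨x - q - 1, by omega⟩, ?_, ?_⟩
    · rw [← hπ.fract_lt_iff]
      convert fract_lt_fract_sub hxq using 2
      simp only [Nat.sub_sub]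
      rw [Nat.cast_sub (by omega)]
      push_cast
      ring
    · simp only [Nat.sub_sub]
      rw [Nat.cast_sub (by omega)]

theorem natCast_injective (m : ℕ) :
    Function.Injective fun x : Fin (m + 1) => ((x : ℕ) : ZMod (m + 1)) := by
  intro x y h
  have := (ZMod.natCast_eq_natCast_iff' _ _ _).1 h
  rwa [Nat.mod_eq_of_lt x.2, Nat.mod_eq_of_lt y.2, ← Fin.ext_iff] at this

theorem natCast_succ {m : ℕ} {π : Equiv.Perm (Fin (m + 1))}
    (hπ : IsOrderingPerm α (m + 1) π) (hfirst : π 0 = Fin.last m) (i : Fin m) :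
    ((π i.succ : ℕ) : ZMod (m + 1)) =
      (π i.castSucc : ℕ) - (((π (Fin.last m) : ℕ) + 1 : ℕ) : ZMod (m + 1)) := by
  have hex : ∀ i : Fin m, ∃ j : Fin (m + 1), i.castSucc < j ∧ ((π j : ℕ) : ZMod (m + 1)) =
      (π i.castSucc : ℕ) - (((π (Fin.last m) : ℕ) + 1 : ℕ) : ZMod (m + 1)) := fun i => by
    obtain ⟨y, h1, h2⟩ := hπ.exists_symm_lt hfirst
      (x := π i.castSucc) (fun h => (Fin.castSucc_lt_last i).ne (π.injective h))
    exact ⟨π.symm y, by simpa using h1, by simpa using h2⟩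
  choose f hf hf' using hex
  have key := eq_succ_of_injOn_of_lt (m := m)
    (f := fun i => if h : i < m then (f ⟨i, h⟩ : ℕ) else 0)
    (fun i hi => by simpa [hi, Fin.lt_def] using hf ⟨i, hi⟩)
    (fun i hi => by simpa [hi] using Fin.is_le (f ⟨i, hi⟩))
    (fun i hi j hj hij => by
      have hi : i < m := hi
      have hj : j < m := hj
      simp only [hi, hj, dif_pos] at hij
      have h := hf' ⟨i, hi⟩
      rw [Fin.ext hij, hf' ⟨j, hj⟩] at h
      simpa using π.injective (natCast_injective m (sub_left_injective h.symm))) i i.2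
  have hfi : f i = i.succ := Fin.ext (by simpa using key)
  rw [← hfi, hf']

theorem natCast_apply {m : ℕ} {π : Equiv.Perm (Fin (m + 1))}
    (hπ : IsOrderingPerm α (m + 1) π) (hfirst : π 0 = Fin.last m) (i : Fin (m + 1)) :
    ((π i : ℕ) : ZMod (m + 1)) =
      -(((π (Fin.last m) : ℕ) + 1 : ℕ) : ZMod (m + 1)) * (i : ℕ) - 1 := by
  induction i using Fin.induction with
  | zero =>
    have h0 : ((m : ZMod (m + 1)) + 1) = 0 := by exact_mod_cast ZMod.natCast_self (m + 1)
    rw [hfirst]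
    simp only [Fin.val_last, Fin.val_zero]
    push_cast
    linear_combination h0
  | succ i ih =>
    rw [hπ.natCast_succ hfirst, ih]
    simp only [Fin.val_castSucc, Fin.val_succ]
    push_cast
    ring

theorem castSucc_apply_eq {m : ℕ} {π : Equiv.Perm (Fin (m + 1))}
    (hπ : IsOrderingPerm α (m + 1) π) (hfirst : π 0 = Fin.last m) {π' : Equiv.Perm (Fin m)}
    (hπ' : IsOrderingPerm α m π') (i : Fin m) : (π' i).castSucc = π i.succ := by
  let f : Fin m → Fin (m + 1) := fun i => π.symm (π' i).castSucc
  have hmono : StrictMono f := fun i j hij => by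
    rw [← hπ.fract_lt_iff]
    simpa using hπ' i j hij
  have hpos : ∀ i, f i ≠ 0 := fun i h => by
    rw [Equiv.symm_apply_eq, hfirst] at h
    exact (Fin.castSucc_lt_last _).ne h
  have hlt : ∀ k (hk : k < m), k < (f ⟨k, hk⟩ : ℕ) := by
    intro k
    induction k with
    | zero => exact fun hk => Fin.pos_iff_ne_zero.2 (hpos _)
    | succ k ih =>
      intro hk
      have h1 := ih (by omega)
      have h2 : (f ⟨k, by omega⟩ : ℕ) < f ⟨k + 1, hk⟩ := hmono (by simp [Fin.lt_def])
      omega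
  have key := eq_succ_of_injOn_of_lt (m := m)
    (f := fun i => if h : i < m then (f ⟨i, h⟩ : ℕ) else 0)
    (fun i hi => by simpa [hi] using hlt i hi)
    (fun i hi => by simpa [hi] using Fin.is_le (f ⟨i, hi⟩))
    (fun i hi j hj hij => by
      have hi : i < m := hi
      have hj : j < m := hj
      simp only [hi, hj, dif_pos] at hij
      simpa using hmono.injective (Fin.ext hij)) i i.2
  have hfi : f i = i.succ := Fin.ext (by simpa using key)
  rwa [Equiv.symm_apply_eq] at hfi

end IsOrderingPerm

theorem orderOf_eq_of_natCast_apply_eq_mul {m : ℕ} (hm : 0 < m) {σ : Equiv.Perm (Fin m)}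
    {a : ZMod (m + 1)}
    (h : ∀ i, (((σ i : ℕ) + 1 : ℕ) : ZMod (m + 1)) = a * ((i : ℕ) + 1 : ℕ)) :
    orderOf σ = orderOf a := by
  have hpow : ∀ (t : ℕ) i,
      ((((σ ^ t) i : ℕ) + 1 : ℕ) : ZMod (m + 1)) = a ^ t * ((i : ℕ) + 1 : ℕ) := by
    intro t
    induction t with
    | zero => simp
    | succ t ih =>
      intro i
      rw [pow_succ', Equiv.Perm.mul_apply, h, ih]
      ring
  rw [orderOf_eq_orderOf_iff]
  intro t
  constructor
  · intro ht
    simpa [ht] using (hpow t ⟨0, hm⟩).symm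
  · intro ht
    ext i
    have h1 := hpow t i
    rw [ht, one_mul] at h1
    have h2 := IsOrderingPerm.natCast_injective m
      (a₁ := ((σ ^ t) i).succ) (a₂ := i.succ) (by simpa using h1)
    simpa [Fin.ext_iff] using h2

theorem pow_eq_one_iff_geom_sum_eq_zero {m : ℕ} {σ : Equiv.Perm (Fin (m + 1))}
    {a : ZMod (m + 1)} (h : ∀ i, ((σ i : ℕ) : ZMod (m + 1)) = a * (i : ℕ) - 1) (t : ℕ) :
    σ ^ t = 1 ↔ ∑ j ∈ Finset.range t, a ^ j = 0 := by
  have hpow : ∀ (t : ℕ) i, (((σ ^ t) i : ℕ) : ZMod (m + 1)) =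
      a ^ t * (i : ℕ) - ∑ j ∈ Finset.range t, a ^ j := by
    intro t
    induction t with
    | zero => simp
    | succ t ih =>
      intro i
      rw [pow_succ', Equiv.Perm.mul_apply, h, ih, geom_sum_succ]
      ring
  constructor
  · intro ht
    simpa [ht] using (hpow t 0).symm
  · intro ht
    have ha : a ^ t = 1 := by
      have := geom_sum_mul a t
      rw [ht, zero_mul] at this
      exact (sub_eq_zero.1 this.symm)
    refine Equiv.ext fun i => IsOrderingPerm.natCast_injective m ?_
    simpa [ht, ha] using hpow t i

theorem neg_pow_eq_one_iff_geom_sum_eq_zero {n q g : ℕ} (hg : 0 < g) (hdvd : g ∣ q + 1)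
    (hcop : Nat.Coprime n ((q + 1) / g)) (t : ℕ) :
    (-(q : ZMod (g * n))) ^ t = 1 ↔ ∑ j ∈ Finset.range t, (-(q : ZMod n)) ^ j = 0 := by
  obtain ⟨h, hh⟩ := hdvd
  rw [hh, Nat.mul_div_cancel_left _ hg] at hcop
  have hgeom := geom_sum_mul (-(q : ℤ)) t
  set S : ℤ := ∑ j ∈ Finset.range t, (-(q : ℤ)) ^ j with hS
  have h1 : (-(q : ZMod (g * n))) ^ t = 1 ↔ ((g * n : ℕ) : ℤ) ∣ (-(q : ℤ)) ^ t - 1 := by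
    rw [← ZMod.intCast_zmod_eq_zero_iff_dvd]
    push_cast
    rw [sub_eq_zero]
  have h2 : ∑ j ∈ Finset.range t, (-(q : ZMod n)) ^ j = 0 ↔ (n : ℤ) ∣ S := by
    rw [← ZMod.intCast_zmod_eq_zero_iff_dvd, hS]
    push_cast
    rfl
  have hh' : (q : ℤ) + 1 = g * h := by exact_mod_cast hh
  have h3 : (-(q : ℤ)) ^ t - 1 = -(g * (S * h)) := by
    linear_combination -hgeom - S * hh'
  rw [h1, h2, h3, dvd_neg, Nat.cast_mul, mul_dvd_mul_iff_left (by exact_mod_cast hg.ne')]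
  exact ⟨(Nat.isCoprime_iff_coprime.2 hcop).dvd_of_dvd_mul_right, fun hd => hd.mul_right _⟩

/-- If `π_{α,n}(1) = n` (with `n ≥ 2`) and `g` is the least positive integer dividing
`π_{α,n}(n) + 1` with `gcd(n, (π_{α,n}(n)+1)/g) = 1`, then `ord(π_{α,n-1})` is the
multiplicative order of `−π_{α,n}(n)` mod `n` and `ord(π_{α,n})` is the multiplicative
order of `−π_{α,n}(n)` mod `g·n`. -/
theorem order_of_orderingPerm_first_is_n (α : ℝ) (hα : Irrational α) (n : ℕ) (hn : 2 ≤ n)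
    (π : Equiv.Perm (Fin n)) (hπ : IsOrderingPerm α n π)
    (π' : Equiv.Perm (Fin (n - 1))) (hπ' : IsOrderingPerm α (n - 1) π')
    (hfirst : π ⟨0, by omega⟩ = ⟨n - 1, by omega⟩)
    (g : ℕ) (hg : 0 < g)
    (hgdvd : g ∣ ((π ⟨n - 1, by omega⟩ : ℕ) + 1) + 1)
    (hgcop : Nat.Coprime n ((((π ⟨n - 1, by omega⟩ : ℕ) + 1) + 1) / g))
    (hgleast : ∀ g' : ℕ, 0 < g' → g' ∣ ((π ⟨n - 1, by omega⟩ : ℕ) + 1) + 1 →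
      Nat.Coprime n ((((π ⟨n - 1, by omega⟩ : ℕ) + 1) + 1) / g') → g ≤ g') :
    orderOf π' = orderOf (-(((π ⟨n - 1, by omega⟩ : ℕ) + 1 : ℕ) : ZMod n)) ∧
      orderOf π = orderOf (-(((π ⟨n - 1, by omega⟩ : ℕ) + 1 : ℕ) : ZMod (g * n))) := by
  obtain ⟨m, rfl⟩ : ∃ m, n = m + 1 := ⟨n - 1, by omega⟩
  have hfirst' : π 0 = Fin.last m := hfirst
  have happly := hπ.natCast_apply hfirst'
  refine ⟨orderOf_eq_of_natCast_apply_eq_mul (by omega) fun i => ?_, ?_⟩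
  · have h1 := happly i.succ
    rw [← hπ.castSucc_apply_eq hfirst' hπ' i, Fin.val_succ, Fin.val_castSucc] at h1
    rw [Nat.cast_succ, h1, sub_add_cancel]
    rfl
  · rw [orderOf_eq_orderOf_iff]
    intro t
    rw [neg_pow_eq_one_iff_geom_sum_eq_zero hg hgdvd hgcop]
    exact pow_eq_one_iff_geom_sum_eq_zero happly t
end

section
/- Let φ = (√5 − 1)/2 and let f_m denote the m-th Fibonacci number (f_1 = f_2 = 1, f_{m+1} = f_m + f_{m−1}). Then for every integer n ≥ 2: ord(π_{φ, f_{2n} − 1}) = ord(π_{φ, f_{2n}}) = 2 and ord(π_{φ, f_{2n+1} − 1}) = ord(π_{φ, f_{2n+1}}) = 4. -/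
section Ordering

theorem eq_val_of_strictMono_int {n : ℕ} {f : Fin n → ℤ} (hf : StrictMono f)
    (h0 : ∀ k, 0 ≤ f k) (hn : ∀ k, f k < n) (k : Fin n) : f k = k := by
  let g : Fin n → Fin n := fun k => ⟨(f k).toNat, by have := h0 k; have := hn k; omega⟩
  have hg : StrictMono g := fun a b hab => by
    have h1 := hf hab
    have h2 := h0 a
    simp only [g, Fin.mk_lt_mk]
    omega
  have hk : g k = k := le_antisymm hg.apply_le hg.le_apply
  have h1 := congrArg Fin.val hk
  have h2 := h0 k
  simp only [g] at h1
  omega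

/-- If `α` is so close to `c / F` that each of `{α}, …, {nα}` lies within `1 / F` of the
corresponding multiple of `1 / F`, then the ordering permutation inverts multiplication by `c`
modulo `F`, up to the offset `e` of the window of residues. -/
theorem IsOrderingPerm.mul_eq_zmod {α δ : ℝ} {n F c : ℕ} {e : ℤ} {π : Equiv.Perm (Fin n)}
    (hπ : IsOrderingPerm α n π) (hF : 0 < F) (hnF : n ≤ F) (hc : c.Coprime F)
    (hα : F * α = c + δ) (hδ : F * |δ| < 1)
    (hlt : ∀ i < n, (((i : ℤ) + 1) * c - e) % F < n)
    (hnonneg : ∀ i < n, 0 ≤ (((((i : ℤ) + 1) * c - e) % F + e : ℤ) : ℝ) + (i + 1) * δ)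
    (hltF : ∀ i < n, (((((i : ℤ) + 1) * c - e) % F + e : ℤ) : ℝ) + (i + 1) * δ < F)
    (k : Fin n) : (((π k : ℕ) : ZMod F) + 1) * c = (k : ℕ) + e := by
  have hFR : (0 : ℝ) < F := by exact_mod_cast hF
  set r : ℕ → ℤ := fun i => (((i : ℤ) + 1) * c - e) % F with hr
  have hfract (i : ℕ) (hi : i < n) :
      Int.fract (((i : ℕ) + 1 : ℝ) * α) * F = ((r i + e : ℤ) : ℝ) + (i + 1) * δ := by
    have hmod : (F : ℝ) * ((((i : ℤ) + 1) * c - e) / F : ℤ) + r i = (i + 1) * c - e := by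
      have := Int.mul_ediv_add_emod (((i : ℤ) + 1) * c - e) F
      exact_mod_cast this
    have hval : Int.fract (((i : ℕ) + 1 : ℝ) * α) = (((r i + e : ℤ) : ℝ) + (i + 1) * δ) / F := by
      rw [Int.fract_eq_iff]
      refine ⟨div_nonneg (hnonneg i hi) hFR.le, (div_lt_one hFR).2 (hltF i hi),
        (((i : ℤ) + 1) * c - e) / F, ?_⟩
      field_simp
      push_cast
      linear_combination (i + 1 : ℝ) * hα - hmod
    rw [hval]
    field_simp
  have hmono : StrictMono fun k => r (π k) := by
    intro a b hab
    have h1 := mul_lt_mul_of_pos_right (hπ a b hab) hFR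
    rw [hfract _ (π a).2, hfract _ (π b).2] at h1
    push_cast at h1
    have h2 : |((π a : ℕ) : ℝ) - (π b : ℕ)| * |δ| ≤ F * |δ| := by
      refine mul_le_mul_of_nonneg_right ?_ (abs_nonneg _)
      have ha : ((π a : ℕ) : ℝ) ≤ F := by exact_mod_cast ((π a).2.le.trans hnF)
      have hb : ((π b : ℕ) : ℝ) ≤ F := by exact_mod_cast ((π b).2.le.trans hnF)
      have ha0 : (0 : ℝ) ≤ (π a : ℕ) := Nat.cast_nonneg _
      have hb0 : (0 : ℝ) ≤ (π b : ℕ) := Nat.cast_nonneg _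
      rw [abs_le]
      constructor <;> linarith
    rw [← abs_mul] at h2
    have h3 := neg_abs_le ((((π a : ℕ) : ℝ) - (π b : ℕ)) * δ)
    have h4 : ((r (π a) : ℝ)) < r (π b) + 1 := by linarith
    have h5 : r (π a) ≤ r (π b) := by
      have : r (π a) < r (π b) + 1 := by exact_mod_cast h4
      omega
    refine lt_of_le_of_ne h5 fun heq => hab.ne (π.injective (Fin.ext ?_))
    have h6 : (F : ℤ) ∣ (((π b : ℕ) : ℤ) - (π a : ℕ)) * c := by
      have := Int.ModEq.dvd (n := F) heq
      convert this using 1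
      ring
    have h7 := (Nat.isCoprime_iff_coprime.2 hc).symm.dvd_of_dvd_mul_right h6
    have h8 := Int.eq_zero_of_abs_lt_dvd h7 (by
      have := (π a).2
      have := (π b).2
      rw [abs_lt]; omega)
    omega
  have hval := eq_val_of_strictMono_int hmono
    (fun _ => Int.emod_nonneg _ (by exact_mod_cast hF.ne')) (fun k => hlt _ (π k).2) k
  have h := congrArg (Int.cast : ℤ → ZMod F) hval
  simp only [hr, ZMod.intCast_mod] at h
  push_cast at h
  linear_combination h

end Ordering

section Order

variable {n F : ℕ} {c : ZMod F} {π : Equiv.Perm (Fin n)}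

theorem Fin.eq_of_natCast_zmod_eq (hnF : n ≤ F) {a b : Fin n}
    (h : ((a : ℕ) : ZMod F) = (b : ℕ)) : a = b := by
  rw [ZMod.natCast_eq_natCast_iff', Nat.mod_eq_of_lt (a.2.trans_le hnF),
    Nat.mod_eq_of_lt (b.2.trans_le hnF)] at h
  exact Fin.ext h

theorem orderOf_eq_two_of_mul_eq_zmod (hn : 0 < n) (hnF : n ≤ F) (hc : c * c = 1) (hc1 : c ≠ 1)
    (h : ∀ k, (((π k : ℕ) : ZMod F) + 1) * c = (k : ℕ) + 1) : orderOf π = 2 := by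
  refine orderOf_eq_prime ?_ fun h1 => hc1 ?_
  · ext1 k
    refine Fin.eq_of_natCast_zmod_eq hnF ?_
    simp only [pow_two, Equiv.Perm.mul_apply, Equiv.Perm.one_apply]
    linear_combination c * h (π k) + h k - ((π (π k) : ℕ) + 1 : ZMod F) * hc
  · have := h ⟨0, hn⟩
    simpa [h1] using this

theorem orderOf_eq_four_of_mul_eq_zmod (hn : 0 < n) (hnF : n ≤ F) (hc : c * c = -1)
    (h2 : (2 : ZMod F) ≠ 0) (h : ∀ k, (((π k : ℕ) : ZMod F) + 1) * c = (k : ℕ) + 1) :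
    orderOf π = 4 := by
  have hsq (k : Fin n) : ((π (π k) : ℕ) : ZMod F) + 1 = -((k : ℕ) + 1) := by
    linear_combination -(c * h (π k)) - h k + ((π (π k) : ℕ) + 1 : ZMod F) * hc
  refine orderOf_eq_prime_pow (p := 2) (n := 1) (fun h1 => h2 ?_) ?_
  · have h3 := hsq ⟨0, hn⟩
    rw [← Equiv.Perm.mul_apply, ← pow_two, ← pow_one 2, h1] at h3
    simp only [Equiv.Perm.one_apply, Nat.cast_zero] at h3
    linear_combination h3
  · ext1 k
    refine Fin.eq_of_natCast_zmod_eq hnF ?_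
    change ((π (π (π (π k))) : ℕ) : ZMod F) = (k : ℕ)
    linear_combination hsq (π (π k)) - hsq k

theorem orderOf_eq_four_of_mul_eq_zmod_zero (hn : 0 < n) (hnF : n ≤ F) (hc : c * c = -1)
    (hc1 : c ≠ 1) (h : ∀ k, (((π k : ℕ) : ZMod F) + 1) * c = (k : ℕ)) : orderOf π = 4 := by
  have hsq (k : Fin n) : ((π (π k) : ℕ) : ZMod F) + 1 = c - (k : ℕ) := by
    linear_combination -(c * h (π k)) - h k + ((π (π k) : ℕ) + 1 : ZMod F) * hc
  refine orderOf_eq_prime_pow (p := 2) (n := 1) (fun h1 => hc1 ?_) ?_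
  · have h3 := hsq ⟨0, hn⟩
    rw [← Equiv.Perm.mul_apply, ← pow_two, ← pow_one 2, h1] at h3
    simp only [Equiv.Perm.one_apply, Nat.cast_zero] at h3
    linear_combination -h3
  · ext1 k
    refine Fin.eq_of_natCast_zmod_eq hnF ?_
    change ((π (π (π (π k))) : ℕ) : ZMod F) = (k : ℕ)
    linear_combination hsq (π (π k)) - hsq k

end Order

section Golden

variable {φ : ℝ}

theorem Nat.fib_succ_mul_eq (hφ : φ ^ 2 = 1 - φ) (m : ℕ) :
    (Nat.fib (m + 1) : ℝ) * φ = Nat.fib m + -(-φ) ^ (m + 1) := by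
  induction m with
  | zero => simp
  | succ m ih =>
    rw [Nat.fib_add_two]
    push_cast
    have h : (-φ) ^ (m + 1 + 1) = -φ * (-φ) ^ (m + 1) := by ring
    rw [h]
    have h0 : (Nat.fib (m + 1) : ℝ) * φ ^ 2 = Nat.fib m * φ - (-φ) ^ (m + 1) * φ := by
      linear_combination φ * ih
    rw [hφ] at h0
    linear_combination -h0

theorem Nat.fib_succ_mul_pow_le_one (hφ0 : 0 ≤ φ) (hφ1 : φ ≤ 1) (hφ : φ ^ 2 = 1 - φ) (m : ℕ) :
    (Nat.fib (m + 1) : ℝ) * φ ^ m ≤ 1 := by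
  induction m using Nat.twoStepInduction with
  | zero => simp
  | one => simpa using hφ1
  | more m h1 h2 =>
    rw [Nat.fib_add_two (n := m + 1)]
    push_cast
    calc ((Nat.fib (m + 1) : ℝ) + Nat.fib (m + 1 + 1)) * φ ^ (m + 2)
        = (Nat.fib (m + 1) * φ ^ m) * φ ^ 2 + (Nat.fib (m + 1 + 1) * φ ^ (m + 1)) * φ := by ring
      _ ≤ 1 * φ ^ 2 + 1 * φ := by gcongr
      _ = 1 := by linear_combination hφ

theorem Nat.fib_cassini (m : ℕ) :
    (Nat.fib m : ℤ) ^ 2 + Nat.fib m * Nat.fib (m + 1) - Nat.fib (m + 1) ^ 2 = -(-1) ^ m := by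
  induction m with
  | zero => simp
  | succ m ih =>
    rw [Nat.fib_add_two]
    push_cast
    rw [pow_succ]
    linear_combination -ih

theorem Nat.fib_mul_self_zmod (m : ℕ) :
    (Nat.fib m : ZMod (Nat.fib (m + 1))) * Nat.fib m = -(-1) ^ m := by
  have h := congrArg (Int.cast : ℤ → ZMod (Nat.fib (m + 1))) (Nat.fib_cassini m)
  push_cast at h
  rw [ZMod.natCast_self] at h
  linear_combination h

theorem Int.mul_sub_one_emod_lt {F c i : ℕ} (hc : c.Coprime F) (hi : i < F - 1) :
    (((i : ℤ) + 1) * c - 1) % F < (F - 1 : ℕ) := by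
  have h1 := Int.emod_lt_of_pos (((i : ℤ) + 1) * c - 1) (b := (F : ℤ)) (by omega)
  by_contra! h2
  have h3 : (((i : ℤ) + 1) * c - 1) % F = F - 1 := by omega
  have h4 : (F : ℤ) ∣ ((i : ℤ) + 1) * c := by
    have h5 := Int.mul_ediv_add_emod (((i : ℤ) + 1) * c - 1) F
    exact ⟨(((i : ℤ) + 1) * c - 1) / F + 1, by linear_combination h3 - h5⟩
  have h5 := Int.le_of_dvd (by omega)
    ((Nat.isCoprime_iff_coprime.2 hc).symm.dvd_of_dvd_mul_right h4)
  omega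

variable {α δ : ℝ} {F c : ℕ}

theorem IsOrderingPerm.mul_eq_zmod_pred {π : Equiv.Perm (Fin (F - 1))}
    (hπ : IsOrderingPerm α (F - 1) π) (hF : 0 < F) (hc : c.Coprime F)
    (hα : F * α = c + δ) (hδ : F * |δ| < 1) (k : Fin (F - 1)) :
    (((π k : ℕ) : ZMod F) + 1) * c = (k : ℕ) + 1 := by
  have hsmall (i : ℕ) (hi : i < F - 1) : |((i : ℝ) + 1) * δ| < 1 := by
    have : ((i : ℝ) + 1) ≤ F := by exact_mod_cast (by omega : i + 1 ≤ F)
    rw [abs_mul, abs_of_nonneg (by positivity)]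
    exact (mul_le_mul_of_nonneg_right this (abs_nonneg δ)).trans_lt hδ
  have h := hπ.mul_eq_zmod (e := 1) hF (Nat.sub_le _ _) hc hα hδ
    (fun i hi => Int.mul_sub_one_emod_lt hc hi) (fun i hi => ?_) (fun i hi => ?_) k
  · simpa using h
  · have h1 := (abs_lt.1 (hsmall i hi)).1
    have h2 : (0 : ℝ) ≤ ((((i : ℤ) + 1) * c - 1) % F : ℤ) := by
      exact_mod_cast Int.emod_nonneg _ (by omega)
    push_cast at h2 ⊢
    linarith
  · have h1 := (abs_lt.1 (hsmall i hi)).2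
    have h2 : ((((((i : ℤ) + 1) * c - 1) % F + 1 : ℤ)) : ℝ) ≤ ((F - 1 : ℤ) : ℝ) := by
      have := Int.mul_sub_one_emod_lt hc hi
      exact Int.cast_le.2 (by omega)
    push_cast at h2 ⊢
    linarith

theorem IsOrderingPerm.mul_eq_zmod_of_neg {π : Equiv.Perm (Fin F)}
    (hπ : IsOrderingPerm α F π) (hF : 0 < F) (hc : c.Coprime F)
    (hα : F * α = c + δ) (hδ : F * |δ| < 1) (hδ0 : δ < 0) (k : Fin F) :
    (((π k : ℕ) : ZMod F) + 1) * c = (k : ℕ) + 1 := by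
  have hlt (i : ℕ) := Int.emod_lt_of_pos (((i : ℤ) + 1) * c - 1) (b := (F : ℤ)) (by omega)
  have h := hπ.mul_eq_zmod (e := 1) hF le_rfl hc hα hδ
    (fun i hi => hlt i) (fun i hi => ?_) (fun i hi => ?_) k
  · simpa using h
  · have h1 : ((i : ℝ) + 1) * |δ| ≤ F * |δ| :=
      mul_le_mul_of_nonneg_right (by exact_mod_cast hi) (abs_nonneg δ)
    have h2 : (0 : ℝ) ≤ ((((i : ℤ) + 1) * c - 1) % F : ℤ) := by
      exact_mod_cast Int.emod_nonneg _ (by omega)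
    rw [abs_of_neg hδ0] at h1 hδ
    push_cast at h2 ⊢
    linarith
  · have h1 : ((i : ℝ) + 1) * δ < 0 := mul_neg_of_pos_of_neg (by positivity) hδ0
    have h2 : ((((((i : ℤ) + 1) * c - 1) % F + 1 : ℤ)) : ℝ) ≤ ((F : ℤ) : ℝ) :=
      Int.cast_le.2 (hlt i)
    push_cast at h2 ⊢
    linarith

theorem IsOrderingPerm.mul_eq_zmod_of_pos {π : Equiv.Perm (Fin F)}
    (hπ : IsOrderingPerm α F π) (hF : 0 < F) (hc : c.Coprime F)
    (hα : F * α = c + δ) (hδ : F * |δ| < 1) (hδ0 : 0 < δ) (k : Fin F) :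
    (((π k : ℕ) : ZMod F) + 1) * c = (k : ℕ) := by
  have hlt (i : ℕ) := Int.emod_lt_of_pos (((i : ℤ) + 1) * c - 0) (b := (F : ℤ)) (by omega)
  have h := hπ.mul_eq_zmod (e := 0) hF le_rfl hc hα hδ
    (fun i hi => hlt i) (fun i hi => ?_) (fun i hi => ?_) k
  · simpa using h
  · have h2 : (0 : ℝ) ≤ ((((i : ℤ) + 1) * c - 0) % F : ℤ) := by
      exact_mod_cast Int.emod_nonneg _ (by omega)
    push_cast at h2 ⊢
    have : 0 ≤ ((i : ℝ) + 1) * δ := by positivity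
    linarith
  · have h1 : ((i : ℝ) + 1) * |δ| ≤ F * |δ| :=
      mul_le_mul_of_nonneg_right (by exact_mod_cast hi) (abs_nonneg δ)
    have h2 : ((((((i : ℤ) + 1) * c - 0) % F + 0 : ℤ)) : ℝ) ≤ ((F - 1 : ℤ) : ℝ) := by
      have := hlt i
      exact Int.cast_le.2 (by omega)
    rw [abs_of_pos hδ0] at h1 hδ
    push_cast at h2 ⊢
    linarith

theorem Nat.fib_succ_mul_abs_pow_lt_one (hφ0 : 0 < φ) (hφ1 : φ < 1) (hφ : φ ^ 2 = 1 - φ) (m : ℕ) :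
    (Nat.fib (m + 1) : ℝ) * |-(-φ) ^ (m + 1)| < 1 := by
  rw [abs_neg, abs_pow, abs_neg, abs_of_pos hφ0, pow_succ, ← mul_assoc]
  calc _ ≤ 1 * φ := by gcongr; exact Nat.fib_succ_mul_pow_le_one hφ0.le hφ1.le hφ m
    _ < 1 := by simpa using hφ1

theorem Nat.fib_zmod_ne_one {m : ℕ} (hm : 3 ≤ m) :
    (Nat.fib m : ZMod (Nat.fib (m + 1))) ≠ 1 := by
  have h1 := Nat.fib_lt_fib_succ (n := m) (by omega)
  have h2 : 2 ≤ Nat.fib m := (Nat.fib_mono hm : Nat.fib 3 ≤ _)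
  intro h
  have h3 : (Nat.fib m : ZMod (Nat.fib (m + 1))) = (1 : ℕ) := by rw [h, Nat.cast_one]
  rw [ZMod.natCast_eq_natCast_iff', Nat.mod_eq_of_lt h1, Nat.mod_eq_of_lt (by omega)] at h3
  omega

end Golden

/-- With `φ = (√5 − 1)/2` and `f_m` the `m`-th Fibonacci number, for every `n ≥ 2`:
`ord(π_{φ, f_{2n} − 1}) = ord(π_{φ, f_{2n}}) = 2` and
`ord(π_{φ, f_{2n+1} − 1}) = ord(π_{φ, f_{2n+1}}) = 4`. -/
theorem order_of_orderingPerm_golden (n : ℕ) (hn : 2 ≤ n)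
    (πa : Equiv.Perm (Fin (Nat.fib (2 * n) - 1)))
    (hπa : IsOrderingPerm ((Real.sqrt 5 - 1) / 2) (Nat.fib (2 * n) - 1) πa)
    (πb : Equiv.Perm (Fin (Nat.fib (2 * n))))
    (hπb : IsOrderingPerm ((Real.sqrt 5 - 1) / 2) (Nat.fib (2 * n)) πb)
    (πc : Equiv.Perm (Fin (Nat.fib (2 * n + 1) - 1)))
    (hπc : IsOrderingPerm ((Real.sqrt 5 - 1) / 2) (Nat.fib (2 * n + 1) - 1) πc)
    (πd : Equiv.Perm (Fin (Nat.fib (2 * n + 1))))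
    (hπd : IsOrderingPerm ((Real.sqrt 5 - 1) / 2) (Nat.fib (2 * n + 1)) πd) :
    orderOf πa = 2 ∧ orderOf πb = 2 ∧ orderOf πc = 4 ∧ orderOf πd = 4 := by
  set φ : ℝ := (Real.sqrt 5 - 1) / 2 with hφdef
  have h5 : Real.sqrt 5 ^ 2 = 5 := Real.sq_sqrt (by norm_num)
  have hφ : φ ^ 2 = 1 - φ := by rw [hφdef]; linear_combination h5 / 4
  have hφ0 : 0 < φ := by
    have : (1 : ℝ) < Real.sqrt 5 := Real.lt_sqrt_of_sq_lt (by norm_num)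
    rw [hφdef]; linarith
  have hφ1 : φ < 1 := by nlinarith
  obtain ⟨m, rfl⟩ : ∃ m, n = m + 1 := ⟨n - 1, by omega⟩
  have hfib (j : ℕ) (hj : 3 ≤ j) : 2 < Nat.fib (j + 1) :=
    lt_of_lt_of_le (by decide) (Nat.fib_mono (by omega : 4 ≤ j + 1))
  have hcop (j : ℕ) := Nat.fib_coprime_fib_succ j
  have heq := Nat.fib_succ_mul_eq hφ
  have hsmall := Nat.fib_succ_mul_abs_pow_lt_one hφ0 hφ1 hφ
  have he : Even (2 * m + 1 + 1) := ⟨m + 1, by ring⟩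
  have ho : Odd (2 * (m + 1) + 1) := ⟨m + 1, by ring⟩
  have hδe : -(-φ) ^ (2 * m + 1 + 1) < 0 := by
    rw [he.neg_pow]; exact neg_neg_of_pos (pow_pos hφ0 _)
  have hδo : 0 < -(-φ) ^ (2 * (m + 1) + 1) := by
    rw [ho.neg_pow, neg_neg]; exact pow_pos hφ0 _
  have hFe := hfib (2 * m + 1) (by omega)
  have hFo := hfib (2 * (m + 1)) (by omega)
  have hFe0 := Nat.zero_lt_of_lt hFe
  have hFo0 := Nat.zero_lt_of_lt hFo
  have hce : (Nat.fib (2 * m + 1) : ZMod (Nat.fib (2 * m + 1 + 1))) * Nat.fib (2 * m + 1) = 1 := by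
    rw [Nat.fib_mul_self_zmod, Odd.neg_one_pow ⟨m, rfl⟩, neg_neg]
  have hco : (Nat.fib (2 * (m + 1)) : ZMod (Nat.fib (2 * (m + 1) + 1))) * Nat.fib (2 * (m + 1))
      = -1 := by
    rw [Nat.fib_mul_self_zmod, Even.neg_one_pow ⟨m + 1, by ring⟩]
  have hce1 := Nat.fib_zmod_ne_one (m := 2 * m + 1) (by omega)
  have hco1 := Nat.fib_zmod_ne_one (m := 2 * (m + 1)) (by omega)
  have h2 : (2 : ZMod (Nat.fib (2 * (m + 1) + 1))) ≠ 0 := by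
    intro h
    have h3 := (ZMod.natCast_eq_zero_iff 2 _).1 (by exact_mod_cast h)
    exact absurd (Nat.le_of_dvd two_pos h3) (by omega)
  refine ⟨?_, ?_, ?_, ?_⟩
  · exact orderOf_eq_two_of_mul_eq_zmod (Nat.sub_pos_of_lt (one_lt_two.trans hFe)) (Nat.sub_le _ _) hce hce1
      (hπa.mul_eq_zmod_pred hFe0 (hcop _) (heq _) (hsmall _))
  · exact orderOf_eq_two_of_mul_eq_zmod hFe0 le_rfl hce hce1
      (hπb.mul_eq_zmod_of_neg hFe0 (hcop _) (heq _) (hsmall _) hδe)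
  · exact orderOf_eq_four_of_mul_eq_zmod (Nat.sub_pos_of_lt (one_lt_two.trans hFo)) (Nat.sub_le _ _) hco h2
      (hπc.mul_eq_zmod_pred hFo0 (hcop _) (heq _) (hsmall _))
  · exact orderOf_eq_four_of_mul_eq_zmod_zero hFo0 le_rfl hco hco1
      (hπd.mul_eq_zmod_of_pos hFo0 (hcop _) (heq _) (hsmall _) hδo)
end

section
/- Let α be irrational with 0 < α < 1/2 and let k ≥ 3 be an integer. Then B_α(k) + B_{1−α}(k) = k − 1, and (computing in ℤ) B_α(k) − 2·B_α(k−1) + B_α(k−2) equals 1 − k if {kα} ∈ [0, α), equals k − 1 if {kα} ∈ [α, 2α), and equals 0 if {kα} ∈ [2α, 1). -/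
/-- `B α k = #{q : 1 ≤ q < k, {qα} < {kα}}`. -/
noncomputable def B (α : ℝ) (k : ℕ) : ℕ :=
  ((Finset.Ico 1 k).filter fun q : ℕ => Int.fract ((q : ℝ) * α) < Int.fract ((k : ℝ) * α)).card

theorem fract_natCast_mul_injective {α : ℝ} (hα : Irrational α) {q k : ℕ}
    (h : Int.fract ((q : ℝ) * α) = Int.fract ((k : ℝ) * α)) : q = k := by
  obtain ⟨z, hz⟩ := Int.fract_eq_fract.mp h
  by_contra hne
  have hqk : (q : ℤ) - k ≠ 0 := by omega
  refine (hα.intCast_mul hqk).ne_int z ?_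
  push_cast
  linarith

theorem ite_fract_lt_eq_floor {α : ℝ} (hα : Irrational α) {q k : ℕ} (hqk : q < k) :
    (if Int.fract ((q : ℝ) * α) < Int.fract ((k : ℝ) * α) then (1 : ℤ) else 0) =
      1 - ⌊(k : ℝ) * α⌋ + ⌊(q : ℝ) * α⌋ + ⌊((k - q : ℕ) : ℝ) * α⌋ := by
  have hne : Int.fract ((q : ℝ) * α) ≠ Int.fract ((k : ℝ) * α) := fun h =>
    hqk.ne (fract_natCast_mul_injective hα h)
  have hq := Int.floor_add_fract ((q : ℝ) * α)
  have hk := Int.floor_add_fract ((k : ℝ) * α)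
  have hq0 := Int.fract_nonneg ((q : ℝ) * α)
  have hk0 := Int.fract_nonneg ((k : ℝ) * α)
  have hq1 := Int.fract_lt_one ((q : ℝ) * α)
  have hk1 := Int.fract_lt_one ((k : ℝ) * α)
  rw [Nat.cast_sub hqk.le]
  split_ifs with h
  · have : ⌊((k : ℝ) - q) * α⌋ = ⌊(k : ℝ) * α⌋ - ⌊(q : ℝ) * α⌋ := by
      rw [Int.floor_eq_iff]; push_cast; constructor <;> linarith
    linarith
  · have h' := lt_of_le_of_ne (not_lt.mp h) hne.symm
    have : ⌊((k : ℝ) - q) * α⌋ = ⌊(k : ℝ) * α⌋ - ⌊(q : ℝ) * α⌋ - 1 := by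
      rw [Int.floor_eq_iff]; push_cast; constructor <;> linarith
    linarith

theorem B_succ_eq_sum_floor {α : ℝ} (hα : Irrational α) (n : ℕ) :
    (B α (n + 1) : ℤ) =
      n * (1 - ⌊((n + 1 : ℕ) : ℝ) * α⌋) + 2 * ∑ q ∈ Finset.Ico 1 (n + 1), ⌊(q : ℝ) * α⌋ := by
  have hflip : ∑ q ∈ Finset.Ico 1 (n + 1), ⌊((n + 1 - q : ℕ) : ℝ) * α⌋ =
      ∑ q ∈ Finset.Ico 1 (n + 1), ⌊(q : ℝ) * α⌋ := by
    refine Finset.sum_nbij' (fun q => n + 1 - q) (fun q => n + 1 - q) ?_ ?_ ?_ ?_ ?_ <;>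
      intro q hq <;> simp only [Finset.mem_Ico] at * <;> omega
  rw [B, Finset.card_filter]
  simp only [Nat.cast_sum, Nat.cast_ite, Nat.cast_one, Nat.cast_zero]
  rw [Finset.sum_congr rfl fun q hq => ite_fract_lt_eq_floor hα (Finset.mem_Ico.mp hq).2,
    Finset.sum_add_distrib, Finset.sum_add_distrib, hflip, Finset.sum_const, Nat.card_Ico,
    nsmul_eq_mul, Nat.add_sub_cancel]
  ring

theorem fract_natCast_mul_one_sub {α : ℝ} (hα : Irrational α) {q : ℕ} (hq : q ≠ 0) :
    Int.fract ((q : ℝ) * (1 - α)) = 1 - Int.fract ((q : ℝ) * α) := by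
  have hne : Int.fract ((q : ℝ) * α) ≠ 0 := fun h =>
    hq (fract_natCast_mul_injective (k := 0) hα (by simpa using h))
  rw [← Int.fract_neg hne, mul_sub, mul_one, sub_eq_add_neg, Int.fract_natCast_add]

theorem B_add_B_one_sub {α : ℝ} (hα : Irrational α) (k : ℕ) :
    B α k + B (1 - α) k = k - 1 := by
  have hcompl : B (1 - α) k = ((Finset.Ico 1 k).filter fun q : ℕ =>
      ¬ Int.fract ((q : ℝ) * α) < Int.fract ((k : ℝ) * α)).card := by
    rw [B]
    congr 1
    refine Finset.filter_congr fun q hq => ?_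
    obtain ⟨hq1, hqk⟩ := Finset.mem_Ico.mp hq
    have hne : Int.fract ((q : ℝ) * α) ≠ Int.fract ((k : ℝ) * α) := fun h =>
      hqk.ne (fract_natCast_mul_injective hα h)
    rw [fract_natCast_mul_one_sub hα (by omega), fract_natCast_mul_one_sub hα (by omega),
      sub_lt_sub_iff_left, not_lt]
    exact ⟨le_of_lt, fun h => lt_of_le_of_ne h hne.symm⟩
  rw [hcompl, B, Finset.card_filter_add_card_filter_not, Nat.card_Ico]

theorem B_second_difference {α : ℝ} (hα : Irrational α) (m : ℕ) :
    (B α (m + 3) : ℤ) - 2 * B α (m + 2) + B α (m + 1) =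
      -(m + 2) * (⌊((m + 3 : ℕ) : ℝ) * α⌋ - 2 * ⌊((m + 2 : ℕ) : ℝ) * α⌋
        + ⌊((m + 1 : ℕ) : ℝ) * α⌋) := by
  rw [B_succ_eq_sum_floor hα (m + 2), B_succ_eq_sum_floor hα (m + 1), B_succ_eq_sum_floor hα m,
    Finset.sum_Ico_succ_top (by omega : 1 ≤ m + 2), Finset.sum_Ico_succ_top (by omega : 1 ≤ m + 1)]
  simp only [Nat.add_assoc, Nat.reduceAdd]
  generalize ⌊((m + 3 : ℕ) : ℝ) * α⌋ = a
  generalize ⌊((m + 2 : ℕ) : ℝ) * α⌋ = b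
  generalize ⌊((m + 1 : ℕ) : ℝ) * α⌋ = c
  push_cast
  ring

theorem floor_second_difference {α : ℝ} (h0 : 0 < α) (h2 : α < 1 / 2) (x : ℝ) :
    ⌊x⌋ - 2 * ⌊x - α⌋ + ⌊x - 2 * α⌋ =
      if Int.fract x < α then 1 else if Int.fract x < 2 * α then -1 else 0 := by
  have hx := Int.floor_add_fract x
  have hx0 := Int.fract_nonneg x
  have hx1 := Int.fract_lt_one x
  split_ifs with h h'
  · have e1 : ⌊x - α⌋ = ⌊x⌋ - 1 := by
      rw [Int.floor_eq_iff]; push_cast; constructor <;> linarith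
    have e2 : ⌊x - 2 * α⌋ = ⌊x⌋ - 1 := by
      rw [Int.floor_eq_iff]; push_cast; constructor <;> linarith
    omega
  · have e1 : ⌊x - α⌋ = ⌊x⌋ := by
      rw [Int.floor_eq_iff]; constructor <;> linarith
    have e2 : ⌊x - 2 * α⌋ = ⌊x⌋ - 1 := by
      rw [Int.floor_eq_iff]; push_cast; constructor <;> linarith
    omega
  · have e1 : ⌊x - α⌋ = ⌊x⌋ := by
      rw [Int.floor_eq_iff]; constructor <;> linarith
    have e2 : ⌊x - 2 * α⌋ = ⌊x⌋ := by
      rw [Int.floor_eq_iff]; constructor <;> linarith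
    omega

/-- For irrational `0 < α < 1/2` and `k ≥ 3`: `B_α(k) + B_{1−α}(k) = k − 1`, and
`B_α(k) − 2B_α(k−1) + B_α(k−2)` equals `1−k`, `k−1`, or `0` according as `{kα}` lies in
`[0, α)`, `[α, 2α)`, or `[2α, 1)`. -/
theorem B_recurrence (α : ℝ) (hα : Irrational α) (h0 : 0 < α) (h2 : α < 1 / 2)
    (k : ℕ) (hk : 3 ≤ k) :
    B α k + B (1 - α) k = k - 1 ∧
      (B α k : ℤ) - 2 * (B α (k - 1) : ℤ) + (B α (k - 2) : ℤ) =
        if Int.fract ((k : ℝ) * α) < α then 1 - (k : ℤ)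
        else if Int.fract ((k : ℝ) * α) < 2 * α then (k : ℤ) - 1
        else 0 := by
  refine ⟨B_add_B_one_sub hα k, ?_⟩
  obtain ⟨m, rfl⟩ := Nat.exists_eq_add_of_le' hk
  rw [show m + 3 - 1 = m + 2 by omega, show m + 3 - 2 = m + 1 by omega, B_second_difference hα,
    show ((m + 2 : ℕ) : ℝ) * α = ((m + 3 : ℕ) : ℝ) * α - α by push_cast; ring,
    show ((m + 1 : ℕ) : ℝ) * α = ((m + 3 : ℕ) : ℝ) * α - 2 * α by push_cast; ring,
    floor_second_difference h0 h2]
  split_ifs <;> push_cast <;> ring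
end

section
/- Let α ∈ (0,1) be irrational and k ≥ 1 an integer. If k is odd, then B_α(k) is even; if k is even, then B_α(k) ≡ ⌊kα⌋ + 1 (mod 2). -/
theorem Finset.even_card_of_fixedPointFree_involution {ι : Type*} (s : Finset ι) (g : ι → ι)
    (hg : ∀ a ∈ s, g a ∈ s) (hne : ∀ a ∈ s, g a ≠ a) (hinv : ∀ a ∈ s, g (g a) = a) :
    Even s.card := by
  have h : ∑ _a ∈ s, (1 : ZMod 2) = 0 :=
    Finset.sum_involution (fun a _ => g a) (fun _ _ => by decide) (fun a ha _ => hne a ha)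
      hg hinv
  rw [← ZMod.natCast_eq_zero_iff_even]
  simpa using h

theorem Irrational.fract_natCast_mul_pos {α : ℝ} (hα : Irrational α) {q : ℕ} (hq : q ≠ 0) :
    0 < Int.fract ((q : ℝ) * α) :=
  Int.fract_pos.mpr ((hα.natCast_mul hq).ne_int _)

theorem Irrational.fract_natCast_sub_mul_lt {α : ℝ} (hα : Irrational α) {q k : ℕ}
    (hq : q ≠ 0) (hqk : q ≤ k) (h : Int.fract ((q : ℝ) * α) < Int.fract ((k : ℝ) * α)) :
    Int.fract (((k - q : ℕ) : ℝ) * α) < Int.fract ((k : ℝ) * α) := by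
  have hpos := hα.fract_natCast_mul_pos hq
  have hlt := Int.fract_lt_one ((k : ℝ) * α)
  have heq : Int.fract (((k - q : ℕ) : ℝ) * α)
      = Int.fract ((k : ℝ) * α) - Int.fract ((q : ℝ) * α) := by
    rw [Int.fract_eq_iff]
    refine ⟨by linarith, by linarith, ⌊(k : ℝ) * α⌋ - ⌊(q : ℝ) * α⌋, ?_⟩
    push_cast [Nat.cast_sub hqk, Int.fract]
    ring
  linarith

/-- The indices counted by `B α k` other than `k / 2` are paired up by `q ↦ k - q`. -/
theorem even_card_filter_fract_lt_of_two_mul_ne {α : ℝ} (hα : Irrational α) (k : ℕ) :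
    Even (((Finset.Ico 1 k).filter fun q : ℕ =>
      Int.fract ((q : ℝ) * α) < Int.fract ((k : ℝ) * α)).filter fun q => 2 * q ≠ k).card := by
  apply Finset.even_card_of_fixedPointFree_involution _ (fun q => k - q)
  · intro q hq
    simp only [Finset.mem_filter, Finset.mem_Ico] at hq ⊢
    obtain ⟨⟨⟨h1, h2⟩, h3⟩, h4⟩ := hq
    exact ⟨⟨by omega, hα.fract_natCast_sub_mul_lt (by omega) h2.le h3⟩, by omega⟩
  · intro q hq
    simp only [Finset.mem_filter, Finset.mem_Ico] at hq
    omega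
  · intro q hq
    simp only [Finset.mem_filter, Finset.mem_Ico] at hq
    omega

theorem fract_lt_fract_two_mul_and_floor_or {x : ℝ} (hx : 0 < Int.fract x) :
    (Int.fract x < Int.fract (2 * x) ∧ ⌊2 * x⌋ = 2 * ⌊x⌋) ∨
      (¬ Int.fract x < Int.fract (2 * x) ∧ ⌊2 * x⌋ = 2 * ⌊x⌋ + 1) := by
  have h1 := Int.fract_lt_one x
  have h2 := Int.floor_add_fract x
  have h3 := Int.floor_add_fract (2 * x)
  rcases lt_or_ge (Int.fract x) (1 / 2) with h | h
  · have hf : ⌊2 * x⌋ = 2 * ⌊x⌋ := by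
      rw [Int.floor_eq_iff]; push_cast; constructor <;> linarith
    rw [hf] at h3
    push_cast at h3
    exact .inl ⟨by linarith, hf⟩
  · have hf : ⌊2 * x⌋ = 2 * ⌊x⌋ + 1 := by
      rw [Int.floor_eq_iff]; push_cast; constructor <;> linarith
    rw [hf] at h3
    push_cast at h3
    exact .inr ⟨by linarith, hf⟩

/-- For irrational `α ∈ (0,1)` and `k ≥ 1`: if `k` is odd then `B_α(k)` is even, and if
`k` is even then `B_α(k) ≡ ⌊kα⌋ + 1 (mod 2)`. -/
theorem B_parity (α : ℝ) (hα : Irrational α) (h0 : 0 < α) (h1 : α < 1)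
    (k : ℕ) (hk : 1 ≤ k) :
    (Odd k → Even (B α k)) ∧
      (Even k → (B α k : ℤ) ≡ ⌊(k : ℝ) * α⌋ + 1 [ZMOD 2]) := by
  have heven := even_card_filter_fract_lt_of_two_mul_ne hα k
  constructor
  · intro hodd
    rwa [Finset.filter_true_of_mem (fun q _ h => by grind)] at heven
  · rintro ⟨m, rfl⟩
    have hsum := Finset.card_filter_add_card_filter_not
      (s := (Finset.Ico 1 (m + m)).filter fun q : ℕ =>
        Int.fract ((q : ℝ) * α) < Int.fract (((m + m : ℕ) : ℝ) * α)) (fun q => 2 * q ≠ m + m)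
    have hfix : (((Finset.Ico 1 (m + m)).filter fun q : ℕ =>
        Int.fract ((q : ℝ) * α) < Int.fract (((m + m : ℕ) : ℝ) * α)).filter
          fun q => ¬ 2 * q ≠ m + m)
        = if Int.fract ((m : ℝ) * α) < Int.fract (((m + m : ℕ) : ℝ) * α) then {m} else ∅ := by
      ext q
      have hq : 2 * q = m + m ↔ q = m := by omega
      simp only [Finset.mem_filter, Finset.mem_Ico, not_not, hq]
      constructor
      · rintro ⟨⟨-, h⟩, rfl⟩
        rw [if_pos h]
        exact Finset.mem_singleton_self _
      · split_ifs with h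
        · intro hqm
          obtain rfl := Finset.mem_singleton.mp hqm
          exact ⟨⟨by omega, h⟩, rfl⟩
        · simp
    rw [hfix] at hsum
    change _ = B α (m + m) at hsum
    have hm : ((m + m : ℕ) : ℝ) * α = 2 * ((m : ℝ) * α) := by push_cast; ring
    obtain ⟨c, hc⟩ := heven
    rw [hc] at hsum
    rw [Int.ModEq, ← hsum, hm]
    rcases fract_lt_fract_two_mul_and_floor_or (hα.fract_natCast_mul_pos (q := m) (by omega))
      with ⟨h, hf⟩ | ⟨h, hf⟩
    · rw [if_pos h, hf, Finset.card_singleton]; push_cast; omega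
    · rw [if_neg h, hf, Finset.card_empty]; push_cast; omega
end
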